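/- Monotone approximation of the expected log-norms. Assume that the compact set K of Borel probability measures on SL(d,ℝ) satisfies the finite moment condition, the measures condition, and the spaces condition, fix a sequence μ₁, μ₂, … ∈ K, and let λ > 0 be a constant such that L_{[n,m]} ≥ λ(m−n) for all m ≥ n, where L_{[n,m]} = E log‖A_m ⋯ A_{n+1}‖. Define f(n) := min_{m ≥ n} ( L_m − (λ/2)(m − n) ). Then f is increasing (indeed f(n+1) − f(n) ≥ λ/2 > 0), and the differences |f(n) − Lₙ| are uniformly bounded in n; more precisely, there is a constant C such that Lₙ ≥ f(n) ≥ Lₙ − C for all n. -/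

import Mathlib

open MeasureTheory Matrix Filter
open scoped ENNReal

noncomputable section

/-- `SL(d, ℝ)`. -/
abbrev SL (d : ℕ) := Matrix.SpecialLinearGroup (Fin d) ℝ

instance (d : ℕ) : TopologicalSpace (SL d) :=
  inferInstanceAs (TopologicalSpace { A : Matrix (Fin d) (Fin d) ℝ // A.det = 1 })

instance (d : ℕ) : MeasurableSpace (SL d) := borel _
instance (d : ℕ) : BorelSpace (SL d) := ⟨rfl⟩

/-- Operator norm of a real `d × d` matrix, acting on Euclidean space. -/
def opNorm {d : ℕ} (A : Matrix (Fin d) (Fin d) ℝ) : ℝ :=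
  ‖Matrix.toEuclideanCLM (𝕜 := ℝ) A‖

/-- The norm `‖A‖` of `A ∈ SL(d, ℝ)`. -/
def slNorm {d : ℕ} (A : SL d) : ℝ := opNorm (A : Matrix (Fin d) (Fin d) ℝ)

/-- `A` applied to a vector `v ∈ ℝ^d` (with the Euclidean norm). -/
def slVec {d : ℕ} (A : SL d) (v : EuclideanSpace ℝ (Fin d)) : EuclideanSpace ℝ (Fin d) :=
  Matrix.toEuclideanCLM (𝕜 := ℝ) (A : Matrix (Fin d) (Fin d) ℝ) v

/-- The random (reversed) product `Tₙ = Aₙ ⋯ A₂ A₁`, where `Aᵢ = ω (i-1)`. -/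
def T {d : ℕ} (ω : ℕ → SL d) : ℕ → SL d
  | 0 => 1
  | n + 1 => ω n * T ω n

/-- The projective space `ℝP^{d-1}`. -/
abbrev Proj (d : ℕ) := Projectivization ℝ (Fin d → ℝ)

instance (d : ℕ) : TopologicalSpace (Proj d) :=
  inferInstanceAs (TopologicalSpace (Quotient (projectivizationSetoid ℝ (Fin d → ℝ))))

instance (d : ℕ) : MeasurableSpace (Proj d) := borel _
instance (d : ℕ) : BorelSpace (Proj d) := ⟨rfl⟩

/-- The linear map induced by `A ∈ SL(d, ℝ)` is injective. -/
theorem toLin'_injective {d : ℕ} (A : SL d) :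
    Function.Injective (Matrix.toLin' (A : Matrix (Fin d) (Fin d) ℝ)) := by
  apply Function.LeftInverse.injective
    (g := Matrix.toLin' ((A⁻¹ : SL d) : Matrix (Fin d) (Fin d) ℝ))
  intro x
  rw [← Matrix.toLin'_mul_apply, ← Matrix.SpecialLinearGroup.coe_mul, inv_mul_cancel,
    Matrix.SpecialLinearGroup.coe_one, Matrix.toLin'_one, LinearMap.id_apply]

/-- The projective map `f_A : ℝP^{d-1} → ℝP^{d-1}` induced by `A ∈ SL(d, ℝ)`. -/
def projMap {d : ℕ} (A : SL d) : Proj d → Proj d :=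
  Projectivization.map (Matrix.toLin' (A : Matrix (Fin d) (Fin d) ℝ)) (toLin'_injective A)

/-- The subset `[L] ⊆ ℝP^{d-1}` corresponding to a linear subspace `L ≤ ℝ^d`. -/
def projSet {d : ℕ} (L : Submodule ℝ (Fin d → ℝ)) : Set (Proj d) :=
  {x : Proj d | x.submodule ≤ L}

/-- Finite moment condition for a single measure, with exponent `γ` and bound `C`. -/
def FiniteMomentCondition {d : ℕ} (γ C : ℝ) (μ : ProbabilityMeasure (SL d)) : Prop :=
  ∫⁻ A, ENNReal.ofReal (slNorm A ^ γ) ∂(μ : Measure (SL d)) < ENNReal.ofReal C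

/-- Log-moment condition: `∫ log ‖A‖ dμ(A) < ∞`. -/
def LogMomentCondition {d : ℕ} (μ : ProbabilityMeasure (SL d)) : Prop :=
  ∫⁻ A, ENNReal.ofReal (Real.log (slNorm A)) ∂(μ : Measure (SL d)) < ⊤

/-- Measures condition: there are no Borel probability measures `ν₁`, `ν₂` on `ℝP^{d-1}`
with `(f_A)_* ν₁ = ν₂` for `μ`-a.e. `A`. -/
def MeasuresCondition {d : ℕ} (μ : ProbabilityMeasure (SL d)) : Prop :=
  ¬ ∃ (ν₁ ν₂ : ProbabilityMeasure (Proj d)),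
      ∀ᵐ A ∂(μ : Measure (SL d)),
        (ν₁ : Measure (Proj d)).map (projMap A) = (ν₂ : Measure (Proj d))

/-- `U ⊆ ℝ^d` is a (nonempty) finite union of proper nonzero linear subspaces. -/
def IsFiniteUnionOfProperSubspaces {d : ℕ} (U : Set (Fin d → ℝ)) : Prop :=
  ∃ S : Set (Submodule ℝ (Fin d → ℝ)), S.Finite ∧ S.Nonempty ∧
    (∀ W ∈ S, W ≠ ⊥ ∧ W ≠ ⊤) ∧ U = ⋃ W ∈ S, (W : Set (Fin d → ℝ))

/-- `U ⊆ ℝ^d` is a (nonempty) finite union of `j`-dimensional linear subspaces. -/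
def IsFiniteUnionOfDimSubspaces {d : ℕ} (j : ℕ) (U : Set (Fin d → ℝ)) : Prop :=
  ∃ S : Set (Submodule ℝ (Fin d → ℝ)), S.Finite ∧ S.Nonempty ∧
    (∀ W ∈ S, Module.finrank ℝ W = j) ∧ U = ⋃ W ∈ S, (W : Set (Fin d → ℝ))

/-- Spaces condition: there are no two finite unions `U`, `U'` of proper nonzero subspaces
of `ℝ^d` such that `A(U) = U'` for `μ`-a.e. `A`. -/
def SpacesCondition {d : ℕ} (μ : ProbabilityMeasure (SL d)) : Prop :=
  ¬ ∃ U U' : Set (Fin d → ℝ), IsFiniteUnionOfProperSubspaces U ∧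
      IsFiniteUnionOfProperSubspaces U' ∧
      ∀ᵐ (A : SL d) ∂(μ : Measure (SL d)),
        (fun v => Matrix.toLin' (A : Matrix (Fin d) (Fin d) ℝ) v) '' U = U'

/-- `ℙ` is the product measure `μ₁ × μ₂ × ⋯` on sequences, characterized by its
finite-dimensional marginals. -/
def IsProductMeasure {d : ℕ} (μ : ℕ → ProbabilityMeasure (SL d))
    (ℙ : Measure (ℕ → SL d)) : Prop :=
  IsProbabilityMeasure ℙ ∧
    ∀ n : ℕ, ℙ.map (fun ω (i : Fin n) => ω i) =
      Measure.pi (fun i : Fin n => ((μ i : Measure (SL d))))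

/-- `Lₙ = E log ‖Tₙ‖`. -/
def L {d : ℕ} (ℙ : Measure (ℕ → SL d)) (n : ℕ) : ℝ :=
  ∫ ω, Real.log (slNorm (T ω n)) ∂ℙ

/-- `L_{[n,m]} = E log ‖A_m ⋯ A_{n+1}‖`. -/
def Lseg {d : ℕ} (ℙ : Measure (ℕ → SL d)) (n m : ℕ) : ℝ :=
  ∫ ω, Real.log (slNorm (T ω m * (T ω n)⁻¹)) ∂ℙ

open Topology

section LinearGroup

variable {d : ℕ}

theorem SL.isEmbedding_coe :
    IsEmbedding (fun A : SL d => (A : Matrix (Fin d) (Fin d) ℝ)) :=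
  IsEmbedding.subtypeVal

@[fun_prop]
theorem SL.continuous_coe :
    Continuous (fun A : SL d => (A : Matrix (Fin d) (Fin d) ℝ)) :=
  SL.isEmbedding_coe.continuous

instance : IsTopologicalGroup (SL d) where
  continuous_inv := by
    refine SL.isEmbedding_coe.continuous_iff.mpr ?_
    simp only [Function.comp_def, Matrix.SpecialLinearGroup.coe_inv]
    exact SL.continuous_coe.matrix_adjugate
  continuous_mul := by
    refine SL.isEmbedding_coe.continuous_iff.mpr ?_
    simp only [Function.comp_def, Matrix.SpecialLinearGroup.coe_mul]
    exact (SL.continuous_coe.comp continuous_fst).mul (SL.continuous_coe.comp continuous_snd)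

instance : SecondCountableTopology (SL d) :=
  have : SecondCountableTopology (Matrix (Fin d) (Fin d) ℝ) :=
    inferInstanceAs (SecondCountableTopology (Fin d → Fin d → ℝ))
  SL.isEmbedding_coe.secondCountableTopology

instance : TopologicalSpace.MetrizableSpace (SL d) :=
  have : TopologicalSpace.MetrizableSpace (Matrix (Fin d) (Fin d) ℝ) :=
    inferInstanceAs (TopologicalSpace.MetrizableSpace (Fin d → Fin d → ℝ))
  SL.isEmbedding_coe.metrizableSpace

theorem continuous_toEuclideanCLM :
    Continuous (fun A : Matrix (Fin d) (Fin d) ℝ => Matrix.toEuclideanCLM (𝕜 := ℝ) A) :=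
  LinearMap.continuous_of_finiteDimensional
    ((Matrix.toEuclideanCLM (𝕜 := ℝ) (n := Fin d)).toAlgEquiv.toLinearMap)

@[fun_prop]
theorem continuous_slNorm : Continuous (slNorm : SL d → ℝ) :=
  (continuous_toEuclideanCLM.comp SL.continuous_coe).norm

theorem continuous_slVec_comp {X : Type*} [TopologicalSpace X] {f : X → SL d}
    {g : X → EuclideanSpace ℝ (Fin d)} (hf : Continuous f) (hg : Continuous g) :
    Continuous (fun x => slVec (f x) (g x)) := by
  have h1 : Continuous fun x =>
      Matrix.toEuclideanCLM (𝕜 := ℝ) (f x : Matrix (Fin d) (Fin d) ℝ) :=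
    continuous_toEuclideanCLM.comp (SL.continuous_coe.comp hf)
  exact h1.clm_apply hg

theorem slNorm_nonneg (A : SL d) : 0 ≤ slNorm A := norm_nonneg _

@[simp] theorem slVec_one (v : EuclideanSpace ℝ (Fin d)) : slVec 1 v = v := by
  simp [slVec]

theorem slVec_mul (A B : SL d) (v : EuclideanSpace ℝ (Fin d)) :
    slVec (A * B) v = slVec A (slVec B v) := by
  simp [slVec]

theorem slVec_add (A : SL d) (v w : EuclideanSpace ℝ (Fin d)) :
    slVec A (v + w) = slVec A v + slVec A w := map_add _ _ _

theorem slVec_smul (A : SL d) (c : ℝ) (v : EuclideanSpace ℝ (Fin d)) :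
    slVec A (c • v) = c • slVec A v := map_smul _ _ _

theorem slVec_toLp (A : SL d) (v : Fin d → ℝ) :
    slVec A (WithLp.toLp 2 v) =
      WithLp.toLp 2 (Matrix.toLin' (A : Matrix (Fin d) (Fin d) ℝ) v) := by
  simp [slVec, Matrix.toLin'_apply]

theorem norm_slVec_le (A : SL d) (v : EuclideanSpace ℝ (Fin d)) :
    ‖slVec A v‖ ≤ slNorm A * ‖v‖ := ContinuousLinearMap.le_opNorm _ _

theorem slNorm_mul_le (A B : SL d) : slNorm (A * B) ≤ slNorm A * slNorm B := by
  simp only [slNorm, opNorm, Matrix.SpecialLinearGroup.coe_mul, map_mul]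
  exact norm_mul_le _ _

theorem norm_le_slNorm_inv_mul (A : SL d) (v : EuclideanSpace ℝ (Fin d)) :
    ‖v‖ ≤ slNorm A⁻¹ * ‖slVec A v‖ := by
  calc ‖v‖ = ‖slVec A⁻¹ (slVec A v)‖ := by rw [← slVec_mul, inv_mul_cancel, slVec_one]
    _ ≤ _ := norm_slVec_le _ _

theorem slVec_ne_zero (A : SL d) {v : EuclideanSpace ℝ (Fin d)} (hv : v ≠ 0) :
    slVec A v ≠ 0 := by
  intro h
  have := norm_le_slNorm_inv_mul A v
  rw [h, norm_zero, mul_zero] at this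
  exact hv (norm_le_zero_iff.mp this)

theorem norm_slVec_pos (A : SL d) {v : EuclideanSpace ℝ (Fin d)} (hv : ‖v‖ = 1) :
    0 < ‖slVec A v‖ :=
  norm_pos_iff.mpr (slVec_ne_zero A (norm_ne_zero_iff.mp (by simp [hv])))

theorem slNorm_pos (hd : 0 < d) (A : SL d) : 0 < slNorm A := by
  have h := norm_slVec_pos A (v := EuclideanSpace.single ⟨0, hd⟩ 1) (by simp)
  have h' := norm_slVec_le A (EuclideanSpace.single ⟨0, hd⟩ 1)
  simp only [PiLp.norm_single, norm_one, mul_one] at h'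
  linarith

/-- The unit sphere is compact, so the operator norm is attained. -/
theorem exists_norm_slVec_eq (hd : 0 < d) (A : SL d) :
    ∃ v : EuclideanSpace ℝ (Fin d), ‖v‖ = 1 ∧ ‖slVec A v‖ = slNorm A := by
  obtain ⟨v, hv, hmax⟩ := (isCompact_sphere (0 : EuclideanSpace ℝ (Fin d)) 1).exists_isMaxOn
    ⟨EuclideanSpace.single ⟨0, hd⟩ 1, by simp⟩
    (f := fun v => ‖slVec A v‖)
    (continuous_slVec_comp continuous_const continuous_id).norm.continuousOn
  have hv1 : ‖v‖ = 1 := by simpa using hv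
  refine ⟨v, hv1, le_antisymm (by simpa [hv1] using norm_slVec_le A v) ?_⟩
  refine ContinuousLinearMap.opNorm_le_bound _ (norm_nonneg _) fun w => ?_
  rcases eq_or_ne w 0 with rfl | hw
  · simp
  have hw' : 0 < ‖w‖ := norm_pos_iff.mpr hw
  have h := hmax (a := (‖w‖⁻¹ • w)) (by simp [norm_smul, hw'.ne'])
  simp only [Set.mem_ofPred_eq, slVec_smul, norm_smul, norm_inv, norm_norm] at h
  change ‖slVec A w‖ ≤ _
  rwa [inv_mul_le_iff₀ hw', mul_comm] at h

theorem slNorm_le_sum (A : SL d) :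
    slNorm A ≤ ∑ i, ‖slVec A (EuclideanSpace.single i 1)‖ := by
  refine ContinuousLinearMap.opNorm_le_bound _ (by positivity) fun v => ?_
  have hv : v = ∑ i, v i • EuclideanSpace.single i (1 : ℝ) := by
    simpa using ((EuclideanSpace.basisFun (Fin d) ℝ).sum_repr v).symm
  calc ‖Matrix.toEuclideanCLM (𝕜 := ℝ) (A : Matrix (Fin d) (Fin d) ℝ) v‖
      = ‖∑ i, v i • slVec A (EuclideanSpace.single i (1 : ℝ))‖ := by
        conv_lhs => rw [hv]
        rw [map_sum]
        simp only [map_smul]; rfl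
    _ ≤ ∑ i, ‖v i • slVec A (EuclideanSpace.single i (1 : ℝ))‖ := norm_sum_le _ _
    _ ≤ ∑ i, ‖v‖ * ‖slVec A (EuclideanSpace.single i (1 : ℝ))‖ := by
        gcongr with i
        rw [norm_smul]
        gcongr
        exact PiLp.norm_apply_le v i
    _ = _ := by rw [← Finset.mul_sum, mul_comm]

/-- The subadditive function `log⁺ ‖A‖ + log⁺ ‖A⁻¹‖`, which dominates all logarithmic growths. -/
def logSize (A : SL d) : ℝ := Real.posLog (slNorm A) + Real.posLog (slNorm A⁻¹)

theorem logSize_nonneg (A : SL d) : 0 ≤ logSize A :=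
  add_nonneg Real.posLog_nonneg Real.posLog_nonneg

@[fun_prop]
theorem continuous_logSize : Continuous (logSize : SL d → ℝ) := by
  unfold logSize
  fun_prop

theorem logSize_mul_le (A B : SL d) : logSize (A * B) ≤ logSize A + logSize B := by
  have h1 : Real.posLog (slNorm (A * B)) ≤ Real.posLog (slNorm A) + Real.posLog (slNorm B) :=
    (Real.monotoneOn_posLog (slNorm_nonneg _) (mul_nonneg (slNorm_nonneg _) (slNorm_nonneg _))
      (slNorm_mul_le A B)).trans Real.posLog_mul
  have h2 : Real.posLog (slNorm (A * B)⁻¹) ≤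
      Real.posLog (slNorm B⁻¹) + Real.posLog (slNorm A⁻¹) := by
    rw [_root_.mul_inv_rev]
    exact (Real.monotoneOn_posLog (slNorm_nonneg _)
      (mul_nonneg (slNorm_nonneg _) (slNorm_nonneg _))
      (slNorm_mul_le _ _)).trans Real.posLog_mul
  unfold logSize
  linarith

theorem abs_log_norm_slVec_le (A : SL d) {v : EuclideanSpace ℝ (Fin d)} (hv : ‖v‖ = 1) :
    |Real.log ‖slVec A v‖| ≤ logSize A := by
  have hpos := norm_slVec_pos A hv
  have h1 : ‖slVec A v‖ ≤ slNorm A := by simpa [hv] using norm_slVec_le A v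
  have h2 : 1 ≤ slNorm A⁻¹ * ‖slVec A v‖ := by simpa [hv] using norm_le_slNorm_inv_mul A v
  have h3 : 0 < slNorm A⁻¹ := by
    by_contra! h
    nlinarith
  have l1 : Real.log ‖slVec A v‖ ≤ Real.posLog (slNorm A) :=
    (Real.log_le_log hpos h1).trans (le_max_right _ _)
  have l2 : 0 ≤ Real.log (slNorm A⁻¹) + Real.log ‖slVec A v‖ := by
    rw [← Real.log_mul h3.ne' hpos.ne']
    exact Real.log_nonneg h2
  have l3 : Real.log (slNorm A⁻¹) ≤ Real.posLog (slNorm A⁻¹) := le_max_right _ _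
  have p1 := Real.posLog_nonneg (x := slNorm A)
  have p2 := Real.posLog_nonneg (x := slNorm A⁻¹)
  unfold logSize
  rw [abs_le]
  constructor <;> linarith

theorem abs_log_slNorm_le (hd : 0 < d) (A : SL d) : |Real.log (slNorm A)| ≤ logSize A := by
  obtain ⟨v, hv, h⟩ := exists_norm_slVec_eq hd A
  rw [← h]
  exact abs_log_norm_slVec_le A hv

theorem abs_entry_le_slNorm (A : SL d) (i j : Fin d) : |A i j| ≤ slNorm A := by
  have h := norm_slVec_le A (EuclideanSpace.single j 1)
  have h2 := PiLp.norm_apply_le (slVec A (EuclideanSpace.single j 1)) i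
  have h3 : slVec A (EuclideanSpace.single j 1) i = A i j := by
    change slVec A (WithLp.toLp 2 (Pi.single j 1)) i = _
    rw [slVec_toLp]
    simp
  rw [h3, Real.norm_eq_abs] at h2
  simp only [PiLp.norm_single, norm_one, mul_one] at h
  exact h2.trans h

theorem slNorm_le_of_abs_entry_le (A : SL d) {x : ℝ} (h : ∀ i j, |A i j| ≤ x) :
    slNorm A ≤ d * (d * x) := by
  refine (slNorm_le_sum A).trans ?_
  calc ∑ i, ‖slVec A (EuclideanSpace.single i 1)‖ ≤ ∑ _i : Fin d, d * x := by
        gcongr with i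
        change ‖slVec A (WithLp.toLp 2 (Pi.single i 1))‖ ≤ _
        rw [slVec_toLp]
        have hsum : WithLp.toLp 2 (Matrix.toLin' (A : Matrix (Fin d) (Fin d) ℝ) (Pi.single i 1))
            = ∑ j, A j i • EuclideanSpace.single j (1 : ℝ) := by
          ext k
          simp [Finset.sum_apply, Pi.single_apply]
        rw [hsum]
        refine (norm_sum_le _ _).trans ?_
        calc ∑ j, ‖A j i • EuclideanSpace.single j (1 : ℝ)‖ ≤ ∑ _j : Fin d, x := by
              gcongr with j
              simpa [norm_smul] using h j i
          _ = d * x := by simp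
    _ = _ := by simp

theorem slNorm_inv_le (A : SL d) :
    slNorm A⁻¹ ≤ d * (d * (d.factorial * max 1 (slNorm A) ^ d)) := by
  refine slNorm_le_of_abs_entry_le _ fun i j => ?_
  rw [Matrix.SpecialLinearGroup.coe_inv, Matrix.adjugate_apply]
  have := Matrix.det_le (A := (A : Matrix (Fin d) (Fin d) ℝ).updateRow j (Pi.single i 1))
    (abv := AbsoluteValue.abs) (x := max 1 (slNorm A)) (fun k l => by
      rw [Matrix.updateRow_apply]
      split_ifs
      · rw [Pi.single_apply]
        split_ifs <;> simp
      · exact (abs_entry_le_slNorm A k l).trans (le_max_right _ _))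
  simpa using this

/-- The size of `A` is controlled by `log⁺ ‖A‖`. -/
theorem exists_logSize_le (d : ℕ) :
    ∃ a : ℝ, 0 ≤ a ∧ ∀ A : SL d, logSize A ≤ a + (d + 1) * Real.posLog (slNorm A) := by
  refine ⟨Real.posLog (d * (d * d.factorial)), Real.posLog_nonneg, fun A => ?_⟩
  have h1 : Real.posLog (slNorm A⁻¹) ≤
      Real.posLog ((d * (d * d.factorial)) * max 1 (slNorm A) ^ d) := by
    refine Real.monotoneOn_posLog (slNorm_nonneg _) (by simp only [Set.mem_Ici]; positivity) ?_
    refine (slNorm_inv_le A).trans (le_of_eq (by ring))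
  have h2 := Real.posLog_mul (x := (d * (d * d.factorial) : ℝ)) (y := max 1 (slNorm A) ^ d)
  have h3 : Real.posLog (max 1 (slNorm A) ^ d) = d * Real.posLog (slNorm A) := by
    rw [Real.posLog_pow]
    congr 1
    rw [Real.posLog_eq_log_max_one (slNorm_nonneg _), Real.posLog_eq_log]
    rw [abs_of_pos (by positivity)]
    exact le_max_left _ _
  unfold logSize
  linarith

end LinearGroup

section RandomProducts

variable {d : ℕ}

/-- The law of `A * B` for independent `A`, `B` with laws `μ`, `ν`. -/
def mulLaw (μ ν : ProbabilityMeasure (SL d)) : ProbabilityMeasure (SL d) :=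
  (μ.prod ν).map (f := fun p => p.1 * p.2) measurable_mul.aemeasurable

theorem coe_mulLaw (μ ν : ProbabilityMeasure (SL d)) :
    (mulLaw μ ν : Measure (SL d)) = (μ : Measure (SL d)) ∗ₘ (ν : Measure (SL d)) := rfl

theorem mulLaw_assoc (μ ν ρ : ProbabilityMeasure (SL d)) :
    mulLaw (mulLaw μ ν) ρ = mulLaw μ (mulLaw ν ρ) := by
  apply Subtype.ext
  change ((mulLaw (mulLaw μ ν) ρ : ProbabilityMeasure (SL d)) : Measure (SL d)) =
    (mulLaw μ (mulLaw ν ρ) : ProbabilityMeasure (SL d))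
  simp only [coe_mulLaw]
  exact Measure.mconv_assoc _ _ _

theorem mulLaw_one (μ : ProbabilityMeasure (SL d)) : mulLaw μ (diracProba 1) = μ := by
  apply Subtype.ext
  exact Measure.mconv_dirac_one (μ : Measure (SL d))

theorem one_mulLaw (μ : ProbabilityMeasure (SL d)) : mulLaw (diracProba 1) μ = μ := by
  apply Subtype.ext
  exact Measure.dirac_one_mconv (μ : Measure (SL d))

/-- The law of the product `A_{k-1} ⋯ A_0` of independent matrices with laws `κ i`. -/
def prodLaw (κ : ℕ → ProbabilityMeasure (SL d)) : ℕ → ProbabilityMeasure (SL d)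
  | 0 => diracProba 1
  | k + 1 => mulLaw (κ k) (prodLaw κ k)

/-- The sequence of laws started at time `a`. -/
def shiftSeq (a : ℕ) (κ : ℕ → ProbabilityMeasure (SL d)) : ℕ → ProbabilityMeasure (SL d) :=
  fun i => κ (a + i)

theorem shiftSeq_shiftSeq (a b : ℕ) (κ : ℕ → ProbabilityMeasure (SL d)) :
    shiftSeq b (shiftSeq a κ) = shiftSeq (a + b) κ := by
  ext1 i
  simp [shiftSeq, add_assoc]

@[simp] theorem shiftSeq_zero (κ : ℕ → ProbabilityMeasure (SL d)) : shiftSeq 0 κ = κ := by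
  ext1 i
  simp [shiftSeq]

theorem prodLaw_one (κ : ℕ → ProbabilityMeasure (SL d)) : prodLaw κ 1 = κ 0 := by
  simp [prodLaw, mulLaw_one]

theorem prodLaw_add (κ : ℕ → ProbabilityMeasure (SL d)) (a k : ℕ) :
    prodLaw κ (a + k) = mulLaw (prodLaw (shiftSeq a κ) k) (prodLaw κ a) := by
  induction k with
  | zero => simp [prodLaw, one_mulLaw]
  | succ k ih => rw [← add_assoc, prodLaw, ih, prodLaw, mulLaw_assoc]; rfl

theorem continuous_mulLaw :
    Continuous (fun p : ProbabilityMeasure (SL d) × ProbabilityMeasure (SL d) =>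
      mulLaw p.1 p.2) :=
  (ProbabilityMeasure.continuous_map continuous_mul).comp ProbabilityMeasure.continuous_prod

theorem continuous_prodLaw (k : ℕ) :
    Continuous (fun κ : ℕ → ProbabilityMeasure (SL d) => prodLaw κ k) := by
  induction k with
  | zero => exact continuous_const
  | succ k ih => exact continuous_mulLaw.comp ((continuous_apply k).prodMk ih)

theorem continuous_shiftSeq (a : ℕ) :
    Continuous (shiftSeq a : (ℕ → ProbabilityMeasure (SL d)) → _) :=
  continuous_pi fun i => continuous_apply (a + i)

/-- The second moment of `logSize` under `ν` is at most `c`. -/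
def SqMomentLE (ν : ProbabilityMeasure (SL d)) (c : ℝ) : Prop :=
  Integrable (fun A => logSize A ^ 2) (ν : Measure (SL d)) ∧
    ∫ A, logSize A ^ 2 ∂(ν : Measure (SL d)) ≤ c

theorem SqMomentLE.integrable_sq {ν : ProbabilityMeasure (SL d)} {c : ℝ} (h : SqMomentLE ν c)
    {F : SL d → ℝ} (hF : Continuous F) (hb : ∀ A, |F A| ≤ logSize A) :
    Integrable (fun A => F A ^ 2) (ν : Measure (SL d)) := by
  refine h.1.mono' (hF.pow 2).measurable.aestronglyMeasurable (ae_of_all _ fun A => ?_)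
  rw [Real.norm_eq_abs, abs_pow]
  exact pow_le_pow_left₀ (abs_nonneg _) (hb A) 2

theorem SqMomentLE.integral_sq_le {ν : ProbabilityMeasure (SL d)} {c : ℝ} (h : SqMomentLE ν c)
    {F : SL d → ℝ} (hF : Continuous F) (hb : ∀ A, |F A| ≤ logSize A) :
    ∫ A, F A ^ 2 ∂(ν : Measure (SL d)) ≤ c := by
  refine (integral_mono (h.integrable_sq hF hb) h.1 fun A => ?_).trans h.2
  simp only
  rw [← sq_abs]
  exact pow_le_pow_left₀ (abs_nonneg _) (hb A) 2

theorem SqMomentLE.integrable_logSize {ν : ProbabilityMeasure (SL d)} {c : ℝ}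
    (h : SqMomentLE ν c) : Integrable logSize (ν : Measure (SL d)) := by
  refine (h.1.add (integrable_const 1)).mono' continuous_logSize.measurable.aestronglyMeasurable
    (ae_of_all _ fun A => ?_)
  rw [Real.norm_eq_abs, abs_of_nonneg (logSize_nonneg A)]
  simp only [Pi.add_apply]
  nlinarith [sq_nonneg (logSize A - 1), logSize_nonneg A]

theorem SqMomentLE.integrable {ν : ProbabilityMeasure (SL d)} {c : ℝ} (h : SqMomentLE ν c)
    {F : SL d → ℝ} (hF : Continuous F) (hb : ∀ A, |F A| ≤ logSize A) :
    Integrable F (ν : Measure (SL d)) :=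
  h.integrable_logSize.mono' hF.measurable.aestronglyMeasurable (ae_of_all _ hb)

theorem integrable_mulLaw_iff {μ ν : ProbabilityMeasure (SL d)} {F : SL d → ℝ}
    (hF : Continuous F) :
    Integrable F (mulLaw μ ν : Measure (SL d)) ↔
      Integrable (fun p : SL d × SL d => F (p.1 * p.2))
        ((μ : Measure (SL d)).prod (ν : Measure (SL d))) := by
  rw [coe_mulLaw, Measure.mconv,
    integrable_map_measure hF.measurable.aestronglyMeasurable measurable_mul.aemeasurable]
  rfl

theorem integral_mulLaw {μ ν : ProbabilityMeasure (SL d)} {F : SL d → ℝ}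
    (hF : Continuous F) (hi : Integrable F (mulLaw μ ν : Measure (SL d))) :
    ∫ A, F A ∂(mulLaw μ ν : Measure (SL d)) =
      ∫ B, ∫ A, F (A * B) ∂(μ : Measure (SL d)) ∂(ν : Measure (SL d)) := by
  rw [coe_mulLaw, Measure.mconv, integral_map measurable_mul.aemeasurable
    hF.measurable.aestronglyMeasurable]
  exact integral_prod_symm _ ((integrable_mulLaw_iff hF).mp hi)

theorem integrable_integral_mulLaw {μ ν : ProbabilityMeasure (SL d)} {F : SL d → ℝ}
    (hF : Continuous F) (hi : Integrable F (mulLaw μ ν : Measure (SL d))) :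
    Integrable (fun B => ∫ A, F (A * B) ∂(μ : Measure (SL d))) (ν : Measure (SL d)) :=
  ((integrable_mulLaw_iff hF).mp hi).integral_prod_right

theorem le_integral_mulLaw {μ ν : ProbabilityMeasure (SL d)} {F g : SL d → ℝ}
    (hF : Continuous F) (hi : Integrable F (mulLaw μ ν : Measure (SL d)))
    (hg : Integrable g (ν : Measure (SL d)))
    (h : ∀ B, g B ≤ ∫ A, F (A * B) ∂(μ : Measure (SL d))) :
    ∫ B, g B ∂(ν : Measure (SL d)) ≤ ∫ A, F A ∂(mulLaw μ ν : Measure (SL d)) := by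
  rw [integral_mulLaw hF hi]
  exact integral_mono hg (integrable_integral_mulLaw hF hi) h

theorem integral_mulLaw_le {μ ν : ProbabilityMeasure (SL d)} {F g : SL d → ℝ}
    (hF : Continuous F) (hi : Integrable F (mulLaw μ ν : Measure (SL d)))
    (hg : Integrable g (ν : Measure (SL d)))
    (h : ∀ B, ∫ A, F (A * B) ∂(μ : Measure (SL d)) ≤ g B) :
    ∫ A, F A ∂(mulLaw μ ν : Measure (SL d)) ≤ ∫ B, g B ∂(ν : Measure (SL d)) := by
  rw [integral_mulLaw hF hi]
  exact integral_mono (integrable_integral_mulLaw hF hi) hg h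

theorem sqMomentLE_mulLaw {μ ν : ProbabilityMeasure (SL d)} {a b s : ℝ} (hs : 0 < s)
    (hμ : SqMomentLE μ a) (hν : SqMomentLE ν b) :
    SqMomentLE (mulLaw μ ν) ((1 + s) * a + (1 + s⁻¹) * b) := by
  have key : ∀ A B : SL d,
      logSize (A * B) ^ 2 ≤ (1 + s) * logSize A ^ 2 + (1 + s⁻¹) * logSize B ^ 2 := by
    intro A B
    have h1 : logSize (A * B) ^ 2 ≤ (logSize A + logSize B) ^ 2 :=
      pow_le_pow_left₀ (logSize_nonneg _) (logSize_mul_le A B) 2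
    have h2 : 0 ≤ s⁻¹ * (s * logSize A - logSize B) ^ 2 := by positivity
    have h3 : s⁻¹ * (s * logSize A - logSize B) ^ 2 =
        s * logSize A ^ 2 - 2 * logSize A * logSize B + s⁻¹ * logSize B ^ 2 := by
      field_simp
      ring
    linarith
  have hc : Continuous fun A : SL d => logSize A ^ 2 := continuous_logSize.pow 2
  have hi : Integrable (fun A => logSize A ^ 2) (mulLaw μ ν : Measure (SL d)) := by
    rw [integrable_mulLaw_iff hc]
    refine (((hμ.1.const_mul (1 + s)).comp_fst (ν : Measure (SL d))).add
      ((hν.1.const_mul (1 + s⁻¹)).comp_snd (μ : Measure (SL d)))).mono'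
      (by fun_prop : Continuous fun p : SL d × SL d =>
        logSize (p.1 * p.2) ^ 2).measurable.aestronglyMeasurable (ae_of_all _ fun p => ?_)
    rw [Real.norm_eq_abs, abs_of_nonneg (by positivity)]
    exact key p.1 p.2
  refine ⟨hi, ?_⟩
  have hint : Integrable (fun B => (1 + s) * a + (1 + s⁻¹) * logSize B ^ 2)
      (ν : Measure (SL d)) := (integrable_const _).add (hν.1.const_mul _)
  refine (integral_mulLaw_le hc hi hint fun B => ?_).trans ?_
  · have hiB : Integrable (fun A => (1 + s) * logSize A ^ 2 + (1 + s⁻¹) * logSize B ^ 2)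
        (μ : Measure (SL d)) := (hμ.1.const_mul _).add (integrable_const _)
    have hle : ∫ A, logSize (A * B) ^ 2 ∂(μ : Measure (SL d)) ≤
        ∫ A, ((1 + s) * logSize A ^ 2 + (1 + s⁻¹) * logSize B ^ 2) ∂(μ : Measure (SL d)) := by
      refine integral_mono (hiB.mono'
        (by fun_prop : Continuous fun A : SL d =>
          logSize (A * B) ^ 2).measurable.aestronglyMeasurable
        (ae_of_all _ fun A => ?_)) hiB fun A => key A B
      rw [Real.norm_eq_abs, abs_of_nonneg (by positivity)]
      exact key A B
    refine hle.trans ?_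
    rw [integral_add (hμ.1.const_mul _) (integrable_const _), integral_const_mul]
    simp only [integral_const, probReal_univ, one_smul]
    have := hμ.2
    gcongr
  · rw [integral_add (integrable_const _) (hν.1.const_mul _)]
    simp only [integral_const_mul, integral_const, probReal_univ, one_smul]
    have := hν.2
    gcongr

theorem sqMomentLE_prodLaw {κ : ℕ → ProbabilityMeasure (SL d)} {c : ℝ}
    (h : ∀ i, SqMomentLE (κ i) c) (k : ℕ) : SqMomentLE (prodLaw κ k) (c * k ^ 2) := by
  induction k with
  | zero =>
    have h1 : logSize (1 : SL d) = 0 := by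
      refine le_antisymm ?_ (logSize_nonneg _)
      have : slNorm (1 : SL d) ≤ 1 :=
        ContinuousLinearMap.opNorm_le_bound _ zero_le_one fun v => by simp
      have h0 : Real.posLog (slNorm (1 : SL d)) = 0 := by
        rw [Real.posLog_eq_zero_iff, abs_of_nonneg (slNorm_nonneg _)]
        exact this
      simp [logSize, h0]
    refine ⟨?_, ?_⟩
    · exact integrable_dirac (by simp)
    · change ∫ A, logSize A ^ 2 ∂(Measure.dirac (1 : SL d)) ≤ _
      rw [integral_dirac]
      simp [h1]
  | succ k ih =>
    rcases Nat.eq_zero_or_pos k with rfl | hk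
    · rw [zero_add, prodLaw_one]
      simpa using h 0
    · have hk' : (0 : ℝ) < k := by exact_mod_cast hk
      have := sqMomentLE_mulLaw hk' (h k) ih
      have e : (1 + (k : ℝ)) * c + (1 + (k : ℝ)⁻¹) * (c * k ^ 2) = c * ((k + 1 : ℕ) : ℝ) ^ 2 := by
        push_cast
        field_simp
        ring
      rw [e] at this
      exact this

theorem SqMomentLE.integral_logSize_le {ν : ProbabilityMeasure (SL d)} {c t : ℝ}
    (h : SqMomentLE ν c) (ht : 0 < t) : ∫ A, logSize A ∂(ν : Measure (SL d)) ≤ t⁻¹ * c + t := by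
  have h3 : ∫ A, logSize A ∂(ν : Measure (SL d)) ≤
      ∫ A, (t⁻¹ * logSize A ^ 2 + t) ∂(ν : Measure (SL d)) :=
    integral_mono h.integrable_logSize ((h.1.const_mul _).add (integrable_const _))
      fun A => by
        simp only
        have : 0 ≤ t⁻¹ * (logSize A - t) ^ 2 := by positivity
        have e : t⁻¹ * (logSize A - t) ^ 2 = t⁻¹ * logSize A ^ 2 - 2 * logSize A + t := by
          field_simp
          ring
        linarith [logSize_nonneg A]
  rw [integral_add (h.1.const_mul _) (integrable_const _), integral_const_mul] at h3
  simp only [integral_const, probReal_univ, one_smul] at h3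
  refine h3.trans ?_
  have := h.2
  gcongr

theorem integral_logSize_prodLaw_le {κ : ℕ → ProbabilityMeasure (SL d)} {c : ℝ}
    (h : ∀ i, SqMomentLE (κ i) c) (k : ℕ) :
    ∫ A, logSize A ∂(prodLaw κ k : Measure (SL d)) ≤ (c + 1) * k := by
  have hk := sqMomentLE_prodLaw h k
  rcases Nat.eq_zero_or_pos k with rfl | hk0
  · refine le_of_forall_pos_le_add fun ε hε => ?_
    simpa using hk.integral_logSize_le hε
  · have hk' : (0 : ℝ) < k := by exact_mod_cast hk0
    refine (hk.integral_logSize_le hk').trans (le_of_eq ?_)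
    field_simp

end RandomProducts

section Growth

variable {d : ℕ}

theorem continuous_log_norm_slVec {u : EuclideanSpace ℝ (Fin d)} (hu : ‖u‖ = 1) :
    Continuous fun A : SL d => Real.log ‖slVec A u‖ :=
  (continuous_slVec_comp continuous_id continuous_const).norm.log
    fun A => (norm_slVec_pos A hu).ne'

theorem continuous_log_slNorm (hd : 0 < d) : Continuous fun A : SL d => Real.log (slNorm A) :=
  continuous_slNorm.log fun A => ne_of_gt (slNorm_pos hd A)

/-- The expected logarithmic growth of the vector `u`. -/
def logGrowth (ν : ProbabilityMeasure (SL d)) (u : EuclideanSpace ℝ (Fin d)) : ℝ :=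
  ∫ A, Real.log ‖slVec A u‖ ∂(ν : Measure (SL d))

/-- The direction of the image `B u`. -/
def imageDir (B : SL d) (u : EuclideanSpace ℝ (Fin d)) : EuclideanSpace ℝ (Fin d) :=
  ‖slVec B u‖⁻¹ • slVec B u

theorem norm_imageDir (B : SL d) {u : EuclideanSpace ℝ (Fin d)} (hu : ‖u‖ = 1) :
    ‖imageDir B u‖ = 1 := by
  have := norm_slVec_pos B hu
  simp [imageDir, norm_smul, this.ne']

theorem norm_slVec_mul (A B : SL d) {u : EuclideanSpace ℝ (Fin d)} (hu : ‖u‖ = 1) :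
    ‖slVec (A * B) u‖ = ‖slVec A (imageDir B u)‖ * ‖slVec B u‖ := by
  have := norm_slVec_pos B hu
  rw [slVec_mul, imageDir, slVec_smul, norm_smul, norm_inv, norm_norm]
  field_simp

theorem log_norm_slVec_mul (A B : SL d) {u : EuclideanSpace ℝ (Fin d)} (hu : ‖u‖ = 1) :
    Real.log ‖slVec (A * B) u‖ =
      Real.log ‖slVec A (imageDir B u)‖ + Real.log ‖slVec B u‖ := by
  rw [norm_slVec_mul A B hu, Real.log_mul (norm_slVec_pos A (norm_imageDir B hu)).ne'
    (norm_slVec_pos B hu).ne']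

theorem SqMomentLE.integrable_log_norm_slVec {ν : ProbabilityMeasure (SL d)} {c : ℝ}
    (h : SqMomentLE ν c) {u : EuclideanSpace ℝ (Fin d)} (hu : ‖u‖ = 1) :
    Integrable (fun A => Real.log ‖slVec A u‖) (ν : Measure (SL d)) :=
  h.integrable (continuous_log_norm_slVec hu) fun A => abs_log_norm_slVec_le A hu

theorem SqMomentLE.integrable_log_slNorm {ν : ProbabilityMeasure (SL d)} {c : ℝ}
    (h : SqMomentLE ν c) (hd : 0 < d) :
    Integrable (fun A => Real.log (slNorm A)) (ν : Measure (SL d)) :=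
  h.integrable (continuous_log_slNorm hd) (abs_log_slNorm_le hd)

theorem abs_logGrowth_prodLaw_le {κ : ℕ → ProbabilityMeasure (SL d)} {c : ℝ}
    (h : ∀ i, SqMomentLE (κ i) c) (k : ℕ) {u : EuclideanSpace ℝ (Fin d)} (hu : ‖u‖ = 1) :
    |logGrowth (prodLaw κ k) u| ≤ (c + 1) * k := by
  have hk := sqMomentLE_prodLaw h k
  refine le_trans ?_ (integral_logSize_prodLaw_le h k)
  exact (abs_integral_le_integral_abs).trans (integral_mono
    (hk.integrable_log_norm_slVec hu).abs hk.integrable_logSize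
    fun A => abs_log_norm_slVec_le A hu)

theorem add_le_logGrowth_mulLaw {μ ν : ProbabilityMeasure (SL d)} {a b c m : ℝ}
    (hμ : SqMomentLE μ a) (hν : SqMomentLE ν b) (hμν : SqMomentLE (mulLaw μ ν) c)
    (h : ∀ x : EuclideanSpace ℝ (Fin d), ‖x‖ = 1 → m ≤ logGrowth μ x)
    {u : EuclideanSpace ℝ (Fin d)} (hu : ‖u‖ = 1) :
    m + logGrowth ν u ≤ logGrowth (mulLaw μ ν) u := by
  have hi := hν.integrable_log_norm_slVec hu
  have := le_integral_mulLaw (g := fun B => m + Real.log ‖slVec B u‖)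
    (continuous_log_norm_slVec hu) (hμν.integrable_log_norm_slVec hu)
    ((integrable_const _).add hi) fun B => by
      simp_rw [log_norm_slVec_mul _ B hu]
      rw [integral_add (hμ.integrable_log_norm_slVec (norm_imageDir B hu)) (integrable_const _)]
      simp only [integral_const, probReal_univ, one_smul]
      gcongr
      exact h _ (norm_imageDir B hu)
  rw [integral_add (integrable_const _) hi] at this
  simpa [logGrowth] using this

theorem add_le_integral_log_slNorm_mulLaw (hd : 0 < d) {μ ν : ProbabilityMeasure (SL d)}
    {a b c m : ℝ} (hμ : SqMomentLE μ a) (hν : SqMomentLE ν b) (hμν : SqMomentLE (mulLaw μ ν) c)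
    (h : ∀ x : EuclideanSpace ℝ (Fin d), ‖x‖ = 1 → m ≤ logGrowth μ x) :
    m + ∫ B, Real.log (slNorm B) ∂(ν : Measure (SL d)) ≤
      ∫ A, Real.log (slNorm A) ∂(mulLaw μ ν : Measure (SL d)) := by
  have hi := hν.integrable_log_slNorm hd
  have := le_integral_mulLaw (g := fun B => m + Real.log (slNorm B))
    (continuous_log_slNorm hd) (hμν.integrable_log_slNorm hd)
    ((integrable_const _).add hi) fun B => by
      obtain ⟨u, hu, hBu⟩ := exists_norm_slVec_eq hd B
      have hx := norm_imageDir B hu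
      have hint := (hμ.integrable_log_norm_slVec hx).add
        (integrable_const (μ := (μ : Measure (SL d))) (Real.log (slNorm B)))
      have hle : ∀ A : SL d, Real.log ‖slVec A (imageDir B u)‖ + Real.log (slNorm B) ≤
          Real.log (slNorm (A * B)) := fun A => by
        rw [← hBu, ← log_norm_slVec_mul A B hu]
        refine Real.log_le_log (norm_slVec_pos _ hu) ?_
        simpa [hu] using norm_slVec_le (A * B) u
      have hint' : Integrable (fun A => Real.log (slNorm (A * B))) (μ : Measure (SL d)) := by
        refine (hμ.integrable_logSize.add (integrable_const (logSize B))).mono'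
          ((continuous_log_slNorm hd).comp
            (continuous_mul_const B)).measurable.aestronglyMeasurable
          (ae_of_all _ fun A => ?_)
        exact (abs_log_slNorm_le hd _).trans (logSize_mul_le A B)
      calc m + Real.log (slNorm B)
          ≤ logGrowth μ (imageDir B u) + Real.log (slNorm B) := by
            gcongr
            exact h _ hx
        _ = ∫ A, (Real.log ‖slVec A (imageDir B u)‖ + Real.log (slNorm B))
              ∂(μ : Measure (SL d)) := by
            rw [integral_add (hμ.integrable_log_norm_slVec hx) (integrable_const _)]
            simp [logGrowth]
        _ ≤ _ := integral_mono hint hint' hle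
  rw [integral_add (integrable_const _) hi] at this
  simpa using this

/-- All products with laws in `X` expand every vector at rate at least `b` in mean. -/
def UniformGrowth (X : Set (ℕ → ProbabilityMeasure (SL d))) (b : ℝ) : Prop :=
  ∃ C : ℝ, ∀ κ ∈ X, ∀ N : ℕ, ∀ u : EuclideanSpace ℝ (Fin d), ‖u‖ = 1 →
    b * N - C ≤ logGrowth (prodLaw κ N) u

theorem UniformGrowth.mono {X : Set (ℕ → ProbabilityMeasure (SL d))} {a b : ℝ}
    (h : UniformGrowth X b) (hab : a ≤ b) : UniformGrowth X a := by
  obtain ⟨C, hC⟩ := h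
  refine ⟨C, fun κ hκ N u hu => le_trans ?_ (hC κ hκ N u hu)⟩
  gcongr

theorem uniformGrowth_neg {X : Set (ℕ → ProbabilityMeasure (SL d))} {c : ℝ}
    (hmom : ∀ κ ∈ X, ∀ i, SqMomentLE (κ i) c) : UniformGrowth X (-(c + 1)) :=
  ⟨0, fun κ hκ N u hu => by
    have := (abs_le.mp (abs_logGrowth_prodLaw_le (hmom κ hκ) N hu)).1
    linarith⟩

/-- If from each starting point the mean growth beats `b` before time `J`, it beats it forever. -/
theorem uniformGrowth_of_exists_time {X : Set (ℕ → ProbabilityMeasure (SL d))} {b c : ℝ} {J : ℕ}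
    (hshift : ∀ κ ∈ X, ∀ a, shiftSeq a κ ∈ X) (hc : 0 ≤ c)
    (hmom : ∀ κ ∈ X, ∀ i, SqMomentLE (κ i) c)
    (h : ∀ κ ∈ X, ∀ u : EuclideanSpace ℝ (Fin d), ‖u‖ = 1 →
      ∃ j, 1 ≤ j ∧ j ≤ J ∧ b * j ≤ logGrowth (prodLaw κ j) u) : UniformGrowth X b := by
  refine ⟨(|b| + (c + 1)) * J, fun κ hκ N => ?_⟩
  induction N using Nat.strong_induction_on generalizing κ with
  | _ N ih =>
    intro u hu
    rcases lt_or_ge N J with hN | hN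
    · have h1 := (abs_le.mp (abs_logGrowth_prodLaw_le (hmom κ hκ) N hu)).1
      have h2 : (N : ℝ) ≤ J := by exact_mod_cast hN.le
      have h3 : b * N ≤ |b| * J :=
        (mul_le_mul_of_nonneg_right (le_abs_self b) (Nat.cast_nonneg N)).trans
          (mul_le_mul_of_nonneg_left h2 (abs_nonneg b))
      have h4 : (c + 1) * N ≤ (c + 1) * J := mul_le_mul_of_nonneg_left h2 (by linarith)
      linarith
    · obtain ⟨j, hj1, hjJ, hj⟩ := h κ hκ u hu
      obtain ⟨k, rfl⟩ := Nat.exists_eq_add_of_le (hjJ.trans hN)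
      have hmom' := hmom _ (hshift κ hκ j)
      have := add_le_logGrowth_mulLaw (sqMomentLE_prodLaw hmom' k)
        (sqMomentLE_prodLaw (hmom κ hκ) j)
        (prodLaw_add κ j k ▸ sqMomentLE_prodLaw (hmom κ hκ) (j + k))
        (ih k (by omega) _ (hshift κ hκ j)) hu
      rw [prodLaw_add]
      push_cast
      linarith

/-- The mean square of the deficit of growth of `u` below the level `p`. -/
def sqDeficit (ν : ProbabilityMeasure (SL d)) (u : EuclideanSpace ℝ (Fin d)) (p : ℝ) : ℝ :=
  ∫ A, max 0 (p - Real.log ‖slVec A u‖) ^ 2 ∂(ν : Measure (SL d))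

theorem SqMomentLE.integrable_sqDeficit {ν : ProbabilityMeasure (SL d)} {c : ℝ}
    (h : SqMomentLE ν c) {u : EuclideanSpace ℝ (Fin d)} (hu : ‖u‖ = 1) (p : ℝ) :
    Integrable (fun A => max 0 (p - Real.log ‖slVec A u‖) ^ 2) (ν : Measure (SL d)) := by
  refine ((integrable_const (2 * p ^ 2)).add (h.1.const_mul 2)).mono'
    ((continuous_const.max (continuous_const.sub
      (continuous_log_norm_slVec hu))).pow 2).measurable.aestronglyMeasurable
    (ae_of_all _ fun A => ?_)
  rw [Real.norm_eq_abs, abs_of_nonneg (by positivity)]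
  simp only [Pi.add_apply]
  have h1 := abs_log_norm_slVec_le A hu
  have h2 : (Real.log ‖slVec A u‖) ^ 2 ≤ logSize A ^ 2 := by
    rw [← sq_abs]; exact pow_le_pow_left₀ (abs_nonneg _) h1 2
  have h3 : max 0 (p - Real.log ‖slVec A u‖) ^ 2 ≤ (p - Real.log ‖slVec A u‖) ^ 2 := by
    rw [← sq_abs (p - _)]
    exact pow_le_pow_left₀ (le_max_left _ _) (max_le (abs_nonneg _) (le_abs_self _)) 2
  nlinarith [sq_nonneg (p + Real.log ‖slVec A u‖)]

theorem sqDeficit_mulLaw_le {μ ν : ProbabilityMeasure (SL d)} {a b c m : ℝ}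
    (hμ : SqMomentLE μ a) (hν : SqMomentLE ν b) (hμν : SqMomentLE (mulLaw μ ν) c)
    (h : ∀ x : EuclideanSpace ℝ (Fin d), ‖x‖ = 1 → m ≤ logGrowth μ x)
    {u : EuclideanSpace ℝ (Fin d)} (hu : ‖u‖ = 1) (p : ℝ) :
    sqDeficit (mulLaw μ ν) u (p + m) ≤ sqDeficit ν u p + (2 * m ^ 2 + 2 * a) := by
  have hi := hν.integrable_sqDeficit hu p
  have := integral_mulLaw_le
    (g := fun B => max 0 (p - Real.log ‖slVec B u‖) ^ 2 + (2 * m ^ 2 + 2 * a))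
    (F := fun A => max 0 (p + m - Real.log ‖slVec A u‖) ^ 2)
    ((continuous_const.max (continuous_const.sub (continuous_log_norm_slVec hu))).pow 2)
    (hμν.integrable_sqDeficit hu (p + m)) (hi.add (integrable_const _)) fun B => by
      have hx := norm_imageDir B hu
      set x := imageDir B u
      set z := p - Real.log ‖slVec B u‖ with hz
      have hlog := hμ.integrable_log_norm_slVec hx
      have hsq := hμ.integrable_sq (continuous_log_norm_slVec hx)
        fun A => abs_log_norm_slVec_le A hx
      have hsq' := hμ.integral_sq_le (continuous_log_norm_slVec hx)
        fun A => abs_log_norm_slVec_le A hx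
      have hrw : ∀ A : SL d, p + m - Real.log ‖slVec (A * B) u‖ =
          (z + m) - Real.log ‖slVec A x‖ := fun A => by
        rw [log_norm_slVec_mul A B hu, hz]; ring
      simp_rw [hrw]
      have hle : ∀ A : SL d, max 0 (z + m - Real.log ‖slVec A x‖) ^ 2 ≤
          max 0 z ^ 2 + 2 * max 0 z * m + 2 * m ^ 2 - 2 * max 0 z * Real.log ‖slVec A x‖ +
            2 * (Real.log ‖slVec A x‖) ^ 2 := by
        intro A
        set y := Real.log ‖slVec A x‖
        have h1 : max 0 (z + m - y) ^ 2 ≤ (max 0 z + (m - y)) ^ 2 ∨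
            max 0 (z + m - y) = 0 := by
          rcases le_total 0 (z + m - y) with h | h
          · left
            refine pow_le_pow_left₀ (le_max_left _ _) ?_ 2
            rw [max_eq_right h]
            linarith [le_max_right 0 z]
          · right
            exact max_eq_left h
        rcases h1 with h1 | h1
        · nlinarith [sq_nonneg (m + y)]
        · rw [h1]
          nlinarith [sq_nonneg (m + y), sq_nonneg (max 0 z + (m - y))]
      have i1 : Integrable (fun A => max 0 z ^ 2 + 2 * max 0 z * m + 2 * m ^ 2 -
          2 * max 0 z * Real.log ‖slVec A x‖) (μ : Measure (SL d)) :=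
        (integrable_const _).sub (hlog.const_mul _)
      have hmono := integral_mono (hμ.integrable_sqDeficit hx (z + m))
        (i1.add (hsq.const_mul 2)) hle
      refine hmono.trans ?_
      simp only [Pi.add_apply]
      rw [integral_add i1 (hsq.const_mul 2),
        integral_sub (integrable_const _) (hlog.const_mul _)]
      simp only [integral_const_mul, integral_const, probReal_univ, one_smul]
      have h5 : 2 * max 0 z * m ≤ 2 * max 0 z * ∫ A, Real.log ‖slVec A x‖ ∂(μ : Measure (SL d)) :=
        mul_le_mul_of_nonneg_left (h x hx) (by positivity)
      linarith
  rw [integral_add hi (integrable_const _)] at this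
  simpa [sqDeficit] using this

theorem sqDeficit_prodLaw_mul_le {κ : ℕ → ProbabilityMeasure (SL d)} {c m : ℝ} {M : ℕ}
    (hmom : ∀ i, SqMomentLE (κ i) c)
    (h : ∀ n, ∀ x : EuclideanSpace ℝ (Fin d), ‖x‖ = 1 →
      m ≤ logGrowth (prodLaw (shiftSeq n κ) M) x)
    {u : EuclideanSpace ℝ (Fin d)} (hu : ‖u‖ = 1) (q : ℕ) :
    sqDeficit (prodLaw κ (q * M)) u (q * m) ≤ q * (2 * m ^ 2 + 2 * (c * M ^ 2)) := by
  induction q with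
  | zero =>
    rw [zero_mul]
    change ∫ A, max 0 ((0 : ℕ) * m - Real.log ‖slVec A u‖) ^ 2 ∂(Measure.dirac (1 : SL d)) ≤ _
    rw [integral_dirac]
    simp [hu]
  | succ q ih =>
    have hm : SqMomentLE (prodLaw κ (q * M + M)) _ := sqMomentLE_prodLaw hmom (q * M + M)
    rw [prodLaw_add] at hm
    have := sqDeficit_mulLaw_le (sqMomentLE_prodLaw (fun i => hmom (q * M + i)) M)
      (sqMomentLE_prodLaw hmom (q * M)) hm (h (q * M)) hu (q * m)
    rw [add_mul, one_mul, prodLaw_add]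
    push_cast
    rw [add_mul, one_mul]
    refine this.trans ?_
    linarith

/-- A vector whose mean growth is at most `m` and whose mean deficit is small rarely grows more
than `t`. -/
theorem mul_measureReal_log_norm_slVec_le {ν : ProbabilityMeasure (SL d)} {c m p t s : ℝ}
    (hν : SqMomentLE ν c) {u : EuclideanSpace ℝ (Fin d)} (hu : ‖u‖ = 1)
    (hm : logGrowth ν u ≤ m) (hs : 0 < s) :
    (t - p) * (ν : Measure (SL d)).real {A | t < Real.log ‖slVec A u‖} ≤
      m - p + s⁻¹ * sqDeficit ν u p + s := by
  have hmeas : MeasurableSet {A : SL d | t < Real.log ‖slVec A u‖} :=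
    measurableSet_lt measurable_const (continuous_log_norm_slVec hu).measurable
  have hlog := hν.integrable_log_norm_slVec hu
  have hdef := hν.integrable_sqDeficit hu p
  have hle : ∀ A : SL d, {A : SL d | t < Real.log ‖slVec A u‖}.indicator (fun _ => t - p) A ≤
      (Real.log ‖slVec A u‖ + (s - p)) + s⁻¹ * max 0 (p - Real.log ‖slVec A u‖) ^ 2 := by
    intro A
    set y := Real.log ‖slVec A u‖
    set w := max 0 (p - y)
    have h0 : 0 ≤ s⁻¹ * (w - s) ^ 2 := by positivity
    have e : s⁻¹ * (w - s) ^ 2 = s⁻¹ * w ^ 2 - 2 * w + s := by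
      field_simp
      ring
    have hw : 0 ≤ w := le_max_left _ _
    have hw' : p - y ≤ w := le_max_right _ _
    have hs' : 0 ≤ s⁻¹ * w ^ 2 := by positivity
    by_cases hA : t < y
    · rw [Set.indicator_of_mem (by exact hA)]
      linarith
    · rw [Set.indicator_of_notMem (by exact hA)]
      linarith
  have i1 : Integrable (fun A => Real.log ‖slVec A u‖ + (s - p)) (ν : Measure (SL d)) :=
    hlog.add (integrable_const _)
  have := integral_mono ((integrable_const (t - p)).indicator hmeas)
    (i1.add (hdef.const_mul s⁻¹)) hle
  simp only [Pi.add_apply] at this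
  rw [integral_indicator_const _ hmeas, integral_add i1 (hdef.const_mul s⁻¹)] at this
  rw [integral_add hlog (integrable_const _), integral_const_mul] at this
  simp only [integral_const, probReal_univ, smul_eq_mul, one_mul] at this
  change _ ≤ logGrowth ν u + (s - p) + s⁻¹ * sqDeficit ν u p at this
  linarith

end Growth

section Continuity

variable {d : ℕ}

/-- Weak continuity of integrals of functions with uniformly bounded second moments. -/
theorem continuous_integral_of_sq_le {Y E : Type*} [TopologicalSpace Y] [TopologicalSpace E]
    [MeasurableSpace E] [OpensMeasurableSpace E] {m : Y → ProbabilityMeasure E}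
    (hm : Continuous m) {g : E → ℝ} (hg : Continuous g) {c : ℝ}
    (hi : ∀ y, Integrable (fun x => g x ^ 2) (m y : Measure E))
    (hc : ∀ y, ∫ x, g x ^ 2 ∂(m y : Measure E) ≤ c) :
    Continuous fun y => ∫ x, g x ∂(m y : Measure E) := by
  have habs : ∀ R : ℝ, 0 ≤ R → ∀ x, |max (-R) (min (g x) R)| ≤ R := fun R hR x => by
    rw [abs_le]
    exact ⟨le_max_left _ _, max_le (by linarith) (min_le_right _ _)⟩
  have hcl : ∀ n : ℕ, Continuous fun x => max (-(n + 1 : ℝ)) (min (g x) (n + 1)) := fun n =>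
    continuous_const.max (hg.min continuous_const)
  let F : ℕ → BoundedContinuousFunction E ℝ := fun n =>
    BoundedContinuousFunction.ofNormedAddCommGroup _ (hcl n) (n + 1) (habs _ (by positivity))
  have hF : ∀ n x, F n x = max (-(n + 1 : ℝ)) (min (g x) (n + 1)) := fun n x => rfl
  have hdist : ∀ n x, |g x - F n x| ≤ ((n : ℝ) + 1)⁻¹ * g x ^ 2 := by
    intro n x
    rw [hF]
    have hR : (0 : ℝ) < n + 1 := by positivity
    set R : ℝ := n + 1
    rw [inv_mul_eq_div, le_div_iff₀ hR]
    rcases le_total (g x) R with h1 | h1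
    · rw [min_eq_left h1]
      rcases le_total (-R) (g x) with h2 | h2
      · rw [max_eq_right h2]
        simp only [sub_self, abs_zero, zero_mul]
        positivity
      · rw [max_eq_left h2, abs_of_nonpos (by linarith)]
        nlinarith
    · rw [min_eq_right h1, max_eq_right (by linarith), abs_of_nonneg (by linarith)]
      nlinarith
  have hint : ∀ y, Integrable g (m y : Measure E) := fun y => by
    refine ((hi y).add (integrable_const 1)).mono' hg.measurable.aestronglyMeasurable
      (ae_of_all _ fun x => ?_)
    simp only [Pi.add_apply, Real.norm_eq_abs]
    rw [← sq_abs (g x)]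
    nlinarith [sq_nonneg (|g x| - 1), abs_nonneg (g x)]
  refine TendstoUniformly.continuous (F := fun n y => ∫ x, F n x ∂(m y : Measure E))
    (p := atTop) ?_ (Eventually.frequently (Eventually.of_forall fun n =>
      (ProbabilityMeasure.continuous_integral_boundedContinuousFunction (F n)).comp hm))
  rw [Metric.tendstoUniformly_iff]
  intro ε hε
  have hlim : Tendsto (fun n : ℕ => ((n : ℝ) + 1)⁻¹ * c) atTop (𝓝 0) := by
    have := (tendsto_one_div_add_atTop_nhds_zero_nat (𝕜 := ℝ)).mul_const c
    simpa using this
  filter_upwards [hlim.eventually_lt_const hε] with n hn y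
  have hFi : Integrable (F n) (m y : Measure E) := (F n).integrable _
  rw [Real.dist_eq, ← integral_sub (hint y) hFi]
  calc |∫ x, (g x - F n x) ∂(m y : Measure E)|
      ≤ ∫ x, |g x - F n x| ∂(m y : Measure E) := abs_integral_le_integral_abs
    _ ≤ ∫ x, ((n : ℝ) + 1)⁻¹ * g x ^ 2 ∂(m y : Measure E) :=
        integral_mono ((hint y).sub hFi).abs ((hi y).const_mul _) (hdist n)
    _ ≤ ((n : ℝ) + 1)⁻¹ * c := by
        rw [integral_const_mul]
        gcongr
        exact hc y
    _ < ε := hn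

theorem continuous_integral_log_slNorm (hd : 0 < d) {Y : Type*} [TopologicalSpace Y]
    {m : Y → ProbabilityMeasure (SL d)} (hm : Continuous m) {c : ℝ}
    (hc : ∀ y, SqMomentLE (m y) c) :
    Continuous fun y => ∫ A, Real.log (slNorm A) ∂(m y : Measure (SL d)) :=
  continuous_integral_of_sq_le hm (continuous_log_slNorm hd)
    (fun y => (hc y).integrable_sq (continuous_log_slNorm hd) (abs_log_slNorm_le hd))
    (fun y => (hc y).integral_sq_le (continuous_log_slNorm hd) (abs_log_slNorm_le hd))

theorem continuous_logGrowth {Y : Type*} [TopologicalSpace Y]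
    {m : Y → ProbabilityMeasure (SL d)} (hm : Continuous m) {c : ℝ}
    (hc : ∀ y, SqMomentLE (m y) c) {u : Y → EuclideanSpace ℝ (Fin d)} (hu : Continuous u)
    (hu1 : ∀ y, ‖u y‖ = 1) :
    Continuous fun y => logGrowth (m y) (u y) := by
  let S := {x : EuclideanSpace ℝ (Fin d) // ‖x‖ = 1}
  let g : SL d × S → ℝ := fun p => Real.log ‖slVec p.1 p.2‖
  have hg : Continuous g :=
    (continuous_slVec_comp continuous_fst (continuous_subtype_val.comp continuous_snd)).norm.log
      fun p => (norm_slVec_pos p.1 p.2.2).ne'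
  let v : Y → S := fun y => ⟨u y, hu1 y⟩
  have hv : Continuous v := hu.subtype_mk _
  let M : Y → ProbabilityMeasure (SL d × S) := fun y => (m y).prod (diracProba (v y))
  have hM : Continuous M :=
    ProbabilityMeasure.continuous_prod.comp (hm.prodMk (continuous_diracProba.comp hv))
  have hMy : ∀ y, (M y : Measure (SL d × S)) =
      (m y : Measure (SL d)).map (fun A => (A, v y)) := fun y =>
    Measure.prod_dirac (v y)
  have hpair : ∀ y, Measurable fun A : SL d => (A, v y) := fun y => by fun_prop
  have hint : ∀ (f : SL d × S → ℝ), Continuous f → ∀ y,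
      ∫ p, f p ∂(M y : Measure (SL d × S)) = ∫ A, f (A, v y) ∂(m y : Measure (SL d)) :=
    fun f hf y => by
      rw [hMy, integral_map (hpair y).aemeasurable hf.measurable.aestronglyMeasurable]
  have hlog : ∀ y, Continuous fun A : SL d => Real.log ‖slVec A (u y)‖ := fun y =>
    continuous_log_norm_slVec (hu1 y)
  have hb := fun (y : Y) (A : SL d) => abs_log_norm_slVec_le A (hu1 y)
  have hg2 : Continuous fun p => g p ^ 2 := hg.pow 2
  have := continuous_integral_of_sq_le (c := c) hM hg (fun y => ?_) (fun y => ?_)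
  · refine this.congr fun y => ?_
    exact hint g hg y
  · rw [hMy, integrable_map_measure hg2.measurable.aestronglyMeasurable
      (hpair y).aemeasurable]
    exact (hc y).integrable_sq (hlog y) (hb y)
  · rw [hint _ hg2]
    exact (hc y).integral_sq_le (hlog y) (hb y)

end Continuity

section SlowDirection

variable {d : ℕ}

/-- If `X` does not grow uniformly at rate `b₀`, then at the critical rate `a ≤ b₀` some sequence in
`X` and some direction never beat `a` in mean. -/
theorem exists_critical_rate {X : Set (ℕ → ProbabilityMeasure (SL d))} {b₀ c : ℝ}
    (hX : IsCompact X) (hshift : ∀ κ ∈ X, ∀ a, shiftSeq a κ ∈ X) (hc : 0 ≤ c)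
    (hmom : ∀ κ ∈ X, ∀ i, SqMomentLE (κ i) c) (hb₀ : ¬ UniformGrowth X b₀) :
    ∃ a ≤ b₀, (∀ b < a, UniformGrowth X b) ∧ ∃ κ ∈ X, ∃ u : EuclideanSpace ℝ (Fin d), ‖u‖ = 1 ∧
      ∀ j : ℕ, 1 ≤ j → logGrowth (prodLaw κ j) u ≤ a * j := by
  set S : Set ℝ := {b | UniformGrowth X b}
  have hub : ∀ b ∈ S, b ≤ b₀ := fun b hb => by
    by_contra! h
    exact hb₀ (UniformGrowth.mono hb h.le)
  have hne : S.Nonempty := ⟨_, uniformGrowth_neg hmom⟩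
  have hbdd : BddAbove S := ⟨b₀, hub⟩
  refine ⟨sSup S, csSup_le hne hub, fun b hb => ?_, ?_⟩
  · obtain ⟨b', hb', hlt⟩ := exists_lt_of_lt_csSup hne hb
    exact UniformGrowth.mono hb' hlt.le
  set a := sSup S
  let E := {x : EuclideanSpace ℝ (Fin d) // x ∈ Metric.sphere (0 : EuclideanSpace ℝ (Fin d)) 1}
  have hE : ∀ x : E, ‖(x : EuclideanSpace ℝ (Fin d))‖ = 1 := fun x => by simp
  have : CompactSpace E := isCompact_iff_compactSpace.mp (isCompact_sphere _ _)
  have : CompactSpace X := isCompact_iff_compactSpace.mp hX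
  have hcont : ∀ j : ℕ, Continuous fun y : X × E => logGrowth (prodLaw y.1.1 j) y.2.1 := fun j =>
    continuous_logGrowth ((continuous_prodLaw j).comp (continuous_subtype_val.comp continuous_fst))
      (fun y => sqMomentLE_prodLaw (hmom _ y.1.2) j)
      (continuous_subtype_val.comp continuous_snd) fun y => hE y.2
  let F : ℕ → Set (X × E) := fun n =>
    {y | ∀ j : ℕ, 1 ≤ j → j ≤ n → logGrowth (prodLaw y.1.1 j) y.2.1 ≤ (a + 1 / ((n : ℝ) + 1)) * j}
  have hFclosed : ∀ n, IsClosed (F n) := fun n => by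
    simp only [F, Set.ofPred_forall]
    exact isClosed_iInter fun j => isClosed_iInter fun _ => isClosed_iInter fun _ =>
      isClosed_le (hcont j) continuous_const
  have hFne : ∀ n, (F n).Nonempty := fun n => by
    by_contra! hempty
    have hpos : 0 < 1 / ((n : ℝ) + 1) := Nat.one_div_pos_of_nat
    have : UniformGrowth X (a + 1 / ((n : ℝ) + 1)) := by
      refine uniformGrowth_of_exists_time (J := n) hshift hc hmom fun κ hκ u hu => ?_
      have hnot : ((⟨⟨κ, hκ⟩, ⟨u, by simpa using hu⟩⟩ : X × E)) ∉ F n := by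
        rw [hempty]
        exact Set.notMem_empty _
      simp only [F, Set.mem_ofPred_eq, not_forall, not_le] at hnot
      obtain ⟨j, h1, h2, h3⟩ := hnot
      exact ⟨j, h1, h2, h3.le⟩
    linarith [le_csSup hbdd this]
  have hFmono : ∀ n, F (n + 1) ⊆ F n := fun n y hy j h1 h2 =>
    (hy j h1 (by omega)).trans (mul_le_mul_of_nonneg_right
      (add_le_add_right (Nat.one_div_le_one_div n.le_succ) a) (Nat.cast_nonneg j))
  obtain ⟨y, hy⟩ := IsCompact.nonempty_iInter_of_sequence_nonempty_isCompact_isClosed F hFmono hFne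
    (hFclosed 0).isCompact hFclosed
  refine ⟨y.1.1, y.1.2, y.2.1, hE y.2, fun j hj => ?_⟩
  have hlim : Tendsto (fun n : ℕ => (a + 1 / ((n : ℝ) + 1)) * j) atTop (𝓝 (a * j)) := by
    simpa using ((tendsto_one_div_add_atTop_nhds_zero_nat (𝕜 := ℝ)).const_add a).mul_const (j : ℝ)
  refine ge_of_tendsto hlim ((eventually_ge_atTop j).mono fun n hn => ?_)
  exact Set.mem_iInter.mp hy n j hj hn

/-- At the critical rate `a`, growth of the slow direction at a rate `t > a` is improbable. -/
theorem exists_measureReal_log_norm_slVec_le {X : Set (ℕ → ProbabilityMeasure (SL d))}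
    {a c t : ℝ} (hshift : ∀ κ ∈ X, ∀ a, shiftSeq a κ ∈ X)
    (hmom : ∀ κ ∈ X, ∀ i, SqMomentLE (κ i) c) (hlt : ∀ b < a, UniformGrowth X b)
    {κ : ℕ → ProbabilityMeasure (SL d)} (hκ : κ ∈ X) {u : EuclideanSpace ℝ (Fin d)} (hu : ‖u‖ = 1)
    (hslow : ∀ j : ℕ, 1 ≤ j → logGrowth (prodLaw κ j) u ≤ a * j) (hat : a < t)
    {ε : ℝ} (hε : 0 < ε) (N₀ : ℕ) :
    ∃ N ≥ N₀, (prodLaw κ N : Measure (SL d)).real {A | t * N < Real.log ‖slVec A u‖} ≤ ε := by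
  set β := t - a with hβ
  have hβ0 : 0 < β := sub_pos.mpr hat
  set η := ε * β / 8 with hη
  have hη0 : 0 < η := by positivity
  obtain ⟨C, hC⟩ := hlt (a - η) (by linarith)
  obtain ⟨M', hM'⟩ := exists_nat_ge (C / η)
  set M := M' + 1
  have hM0 : (0 : ℝ) < M := by positivity
  have hCM : C ≤ η * M := by
    rw [div_le_iff₀ hη0] at hM'
    have : (M : ℝ) = M' + 1 := by simp [M]
    rw [this]
    nlinarith
  set m := (a - 2 * η) * M with hm
  set σ := 2 * m ^ 2 + 2 * (c * M ^ 2) with hσ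
  have hblock : ∀ n, ∀ x : EuclideanSpace ℝ (Fin d), ‖x‖ = 1 →
      m ≤ logGrowth (prodLaw (shiftSeq n κ) M) x := fun n x hx => by
    have := hC _ (hshift κ hκ n) M x hx
    rw [hm]
    linarith
  obtain ⟨q', hq'⟩ := exists_nat_ge (2 * σ / (η * M * (β * ε * M)))
  set q := max (max N₀ 1) q' with hq
  have hq1 : 1 ≤ q := (le_max_right _ _).trans (le_max_left _ _)
  have hqσ : σ / (η * M) ≤ ε * β * (q * M) / 2 := by
    have h1 : 2 * σ / (η * M * (β * ε * M)) ≤ q := hq'.trans (by exact_mod_cast le_max_right _ _)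
    rw [div_le_iff₀ (by positivity)] at h1 ⊢
    linarith
  have hN1 : 1 ≤ q * M := Nat.mul_pos hq1 (by omega)
  have hN0 : (0 : ℝ) < q * M := by exact_mod_cast hN1
  refine ⟨q * M, ?_, ?_⟩
  · calc N₀ ≤ q := (le_max_left _ _).trans (le_max_left _ _)
      _ = q * 1 := (mul_one q).symm
      _ ≤ q * M := Nat.mul_le_mul_left q (by omega)
  have key := mul_measureReal_log_norm_slVec_le (p := q * m) (s := η * (q * M))
    (t := t * (q * M : ℕ)) (sqMomentLE_prodLaw (hmom κ hκ) (q * M)) hu (hslow _ hN1)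
    (by positivity)
  have hdef := sqDeficit_prodLaw_mul_le (hmom κ hκ) hblock hu q
  set P := (prodLaw κ (q * M) : Measure (SL d)).real
    {A | t * (q * M : ℕ) < Real.log ‖slVec A u‖}
  have hP : 0 ≤ P := measureReal_nonneg
  have h2 : (η * (q * M : ℝ))⁻¹ * sqDeficit (prodLaw κ (q * M)) u (q * m) ≤ σ / (η * M) := by
    refine (mul_le_mul_of_nonneg_left hdef (by positivity)).trans_eq ?_
    have : (q : ℝ) ≠ 0 := by positivity
    rw [← hσ]
    field_simp
  push_cast at key
  have h3 : t * (q * M) - q * m = (β + 2 * η) * (q * M) := by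
    rw [hm, hβ]
    ring
  have h4 : a * (q * M) - q * m = 2 * η * (q * M) := by
    rw [hm]
    ring
  rw [h3, h4] at key
  have h5 : 0 ≤ 2 * η * (q * M) * P := by positivity
  have h6 : (q * M : ℝ) * β * P ≤ (q * M : ℝ) * β * ε := by
    have : 3 * η * (q * M) = 3 / 8 * ((q * M : ℝ) * β * ε) := by
      rw [hη]
      ring
    nlinarith [mul_pos (mul_pos hN0 hβ0) hε]
  exact le_of_mul_le_mul_left h6 (by positivity)

end SlowDirection

section SlowSpace

variable {d : ℕ}

/-- The vectors whose growth under `ρ s` exceeds the order of `r s` with summable probability. -/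
def slowSpace (ρ : ℕ → ProbabilityMeasure (SL d)) (r : ℕ → ℝ) :
    Submodule ℝ (Fin d → ℝ) where
  carrier := {v | ∃ R : ℝ, 0 ≤ R ∧
    ∑' s, (ρ s : Measure (SL d)) {A | R * r s < ‖slVec A (WithLp.toLp 2 v)‖} ≠ ∞}
  zero_mem' := ⟨0, le_rfl, by simp [slVec]⟩
  add_mem' := by
    rintro v w ⟨R, hR, hv⟩ ⟨R', hR', hw⟩
    refine ⟨R + R', add_nonneg hR hR', ne_top_of_le_ne_top (ENNReal.add_ne_top.mpr ⟨hv, hw⟩) ?_⟩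
    rw [← ENNReal.tsum_add]
    refine ENNReal.tsum_le_tsum fun s => le_trans (measure_mono fun A hA => ?_)
      (measure_union_le _ _)
    simp only [Set.mem_ofPred_eq, Set.mem_union, WithLp.toLp_add, slVec_add] at hA ⊢
    by_contra! h
    linarith [norm_add_le (slVec A (WithLp.toLp 2 v)) (slVec A (WithLp.toLp 2 w))]
  smul_mem' := by
    rintro a v ⟨R, hR, hv⟩
    refine ⟨|a| * R, mul_nonneg (abs_nonneg a) hR, ne_top_of_le_ne_top hv ?_⟩
    refine ENNReal.tsum_le_tsum fun s => measure_mono fun A hA => ?_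
    simp only [Set.mem_ofPred_eq, WithLp.toLp_smul, slVec_smul, norm_smul, Real.norm_eq_abs,
      mul_assoc] at hA ⊢
    exact lt_of_mul_lt_mul_left hA (abs_nonneg a)

theorem mem_slowSpace {ρ : ℕ → ProbabilityMeasure (SL d)} {r : ℕ → ℝ} {v : Fin d → ℝ} :
    v ∈ slowSpace ρ r ↔ ∃ R : ℝ, 0 ≤ R ∧
      ∑' s, (ρ s : Measure (SL d)) {A | R * r s < ‖slVec A (WithLp.toLp 2 v)‖} ≠ ∞ :=
  Iff.rfl

theorem continuous_norm_slVec (v : EuclideanSpace ℝ (Fin d)) :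
    Continuous fun A : SL d => ‖slVec A v‖ :=
  (continuous_slVec_comp continuous_id continuous_const).norm

theorem ae_toLin'_mem_slowSpace {ρ ρ' : ℕ → ProbabilityMeasure (SL d)} {r : ℕ → ℝ}
    {ν : ProbabilityMeasure (SL d)} (hρ : ∀ s, ρ s = mulLaw (ρ' s) ν) {v : Fin d → ℝ}
    (hv : v ∈ slowSpace ρ r) :
    ∀ᵐ B : SL d ∂(ν : Measure (SL d)),
      Matrix.toLin' (B : Matrix (Fin d) (Fin d) ℝ) v ∈ slowSpace ρ' r := by
  obtain ⟨R, hR, hfin⟩ := mem_slowSpace.mp hv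
  set E : ℕ → Set (SL d × SL d) := fun s =>
    (fun p => p.1 * p.2) ⁻¹' {A | R * r s < ‖slVec A (WithLp.toLp 2 v)‖} with hE
  have hset : ∀ s, MeasurableSet {A : SL d | R * r s < ‖slVec A (WithLp.toLp 2 v)‖} := fun s =>
    measurableSet_lt measurable_const (continuous_norm_slVec _).measurable
  have hEm : ∀ s, MeasurableSet (E s) := fun s => measurable_mul (hset s)
  have hmeas : ∀ s, Measurable fun B => (ρ' s : Measure (SL d)) ((fun A => (A, B)) ⁻¹' E s) :=
    fun s => measurable_measure_prodMk_right (hEm s)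
  have heq : ∀ s, (ρ s : Measure (SL d)) {A | R * r s < ‖slVec A (WithLp.toLp 2 v)‖} =
      ∫⁻ B, (ρ' s : Measure (SL d)) ((fun A => (A, B)) ⁻¹' E s) ∂(ν : Measure (SL d)) := fun s => by
    rw [hρ, coe_mulLaw, Measure.mconv, Measure.map_apply measurable_mul (hset s),
      Measure.prod_apply_symm (hEm s)]
  simp_rw [heq] at hfin
  rw [← lintegral_tsum fun s => (hmeas s).aemeasurable] at hfin
  filter_upwards [ae_lt_top (Measurable.tsum hmeas) hfin] with B hB
  refine mem_slowSpace.mpr ⟨R, hR, ?_⟩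
  convert hB.ne using 5 with s
  ext A
  simp only [hE, Set.mem_ofPred_eq, Set.mem_preimage, slVec_mul, ← slVec_toLp]

theorem ae_map_slowSpace_le {ρ ρ' : ℕ → ProbabilityMeasure (SL d)} {r : ℕ → ℝ}
    {ν : ProbabilityMeasure (SL d)} (hρ : ∀ s, ρ s = mulLaw (ρ' s) ν) :
    ∀ᵐ B : SL d ∂(ν : Measure (SL d)),
      (slowSpace ρ r).map (Matrix.toLin' (B : Matrix (Fin d) (Fin d) ℝ)) ≤ slowSpace ρ' r := by
  obtain ⟨S, hS⟩ := IsNoetherian.noetherian (slowSpace ρ r)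
  have : ∀ᵐ B : SL d ∂(ν : Measure (SL d)), ∀ v ∈ S,
      Matrix.toLin' (B : Matrix (Fin d) (Fin d) ℝ) v ∈ slowSpace ρ' r := by
    rw [Finset.eventually_all]
    exact fun v hv => ae_toLin'_mem_slowSpace hρ (hS ▸ Submodule.subset_span hv)
  filter_upwards [this] with B hB
  rw [← hS, Submodule.map_span_le]
  exact hB

/-- If `E log ‖A‖` grows at rate `lam` along `ρ`, not all vectors are slower than `t < lam`. -/
theorem slowSpace_ne_top (hd : 0 < d) {ρ : ℕ → ProbabilityMeasure (SL d)} {N : ℕ → ℕ}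
    (hN : ∀ s, s ≤ N s) {lam t c b : ℝ} (ht : 0 ≤ t) (htl : t < lam) (hc : 0 ≤ c)
    (hmom : ∀ s, SqMomentLE (ρ s) (c * N s ^ 2))
    (hgrow : ∀ s, lam * N s - b ≤ ∫ A, Real.log (slNorm A) ∂(ρ s : Measure (SL d))) :
    slowSpace ρ (fun s => Real.exp (t * N s)) ≠ ⊤ := by
  intro htop
  have hmem : ∀ i : Fin d, ∃ R : ℝ, 0 ≤ R ∧ ∑' s, (ρ s : Measure (SL d))
      {A | R * Real.exp (t * N s) < ‖slVec A (EuclideanSpace.single i 1)‖} ≠ ∞ := fun i => by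
    have : (Pi.single i 1 : Fin d → ℝ) ∈ slowSpace ρ (fun s => Real.exp (t * N s)) := by
      rw [htop]
      exact Submodule.mem_top
    exact mem_slowSpace.mp this
  choose R hR hfin using hmem
  set D := 1 + ∑ i, R i with hD
  have hD1 : 1 ≤ D := le_add_of_nonneg_right (Finset.sum_nonneg fun i _ => hR i)
  set bad : ℕ → Set (SL d) := fun s => {A | D * Real.exp (t * N s) < slNorm A} with hbad
  have hbadm : ∀ s, MeasurableSet (bad s) := fun s =>
    measurableSet_lt measurable_const continuous_slNorm.measurable
  have hbadle : ∀ s, (ρ s : Measure (SL d)) (bad s) ≤ ∑ i, (ρ s : Measure (SL d))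
      {A | R i * Real.exp (t * N s) < ‖slVec A (EuclideanSpace.single i 1)‖} := fun s => by
    refine le_trans (measure_mono fun A hA => ?_) (measure_iUnion_fintype_le _ _)
    by_contra hnot
    simp only [Set.mem_iUnion, Set.mem_ofPred_eq, not_exists, not_lt] at hnot
    have h1 := (slNorm_le_sum A).trans (Finset.sum_le_sum fun i _ => hnot i)
    rw [← Finset.sum_mul] at h1
    have h2 : D * Real.exp (t * N s) < slNorm A := hA
    rw [hD, add_mul] at h2
    linarith [Real.exp_pos (t * N s)]
  have hlim0 : Tendsto (fun s => (ρ s : Measure (SL d)) (bad s)) atTop (𝓝 0) := by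
    refine tendsto_of_tendsto_of_tendsto_of_le_of_le tendsto_const_nhds ?_
      (fun s => zero_le) hbadle
    rw [← Finset.sum_const_zero (ι := Fin d) (s := Finset.univ)]
    refine tendsto_finsetSum _ fun i _ => ?_
    exact ENNReal.tendsto_atTop_zero_of_tsum_ne_top (hfin i)
  have hlim : Tendsto (fun s => (ρ s : Measure (SL d)).real (bad s)) atTop (𝓝 0) := by
    rw [← ENNReal.toReal_zero]
    exact (ENNReal.tendsto_toReal ENNReal.zero_ne_top).comp hlim0
  set τ := 4 * c / (lam - t) + 1 with hτ
  have hδ : 0 < lam - t := sub_pos.mpr htl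
  have hτ0 : 0 < τ := by positivity
  have hcτ : c ≤ (lam - t) / 4 * τ := by
    rw [hτ]
    field_simp
    linarith
  have hp0 : 0 < (lam - t) / (4 * τ) := by positivity
  obtain ⟨s, hs, hsN⟩ := ((hlim.eventually_lt_const hp0).and
    (tendsto_natCast_atTop_atTop.eventually_gt_atTop
      (2 * (Real.log D + b) / (lam - t) + 1 + |2 * (Real.log D + b) / (lam - t)|))).exists
  set x : ℝ := (N s : ℝ) with hx
  have hsx : (s : ℝ) ≤ x := Nat.cast_le.mpr (hN s)
  have hx1 : 2 * (Real.log D + b) / (lam - t) < x := by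
    linarith [abs_nonneg (2 * (Real.log D + b) / (lam - t))]
  have hx0 : 0 < x := by
    linarith [neg_abs_le (2 * (Real.log D + b) / (lam - t))]
  have hpt : ∀ A : SL d, Real.log (slNorm A) ≤
      (Real.log D + t * x + (τ * x)⁻¹ * logSize A ^ 2) +
        (bad s).indicator (fun _ => τ * x) A := by
    intro A
    have h0 : 0 ≤ (τ * x)⁻¹ * logSize A ^ 2 := by positivity
    have hl : 0 ≤ Real.log D := Real.log_nonneg hD1
    have htx : 0 ≤ t * x := by positivity
    by_cases hA : A ∈ bad s
    · rw [Set.indicator_of_mem hA]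
      have h1 := (abs_le.mp (abs_log_slNorm_le hd A)).2
      have h2 : 0 ≤ (τ * x)⁻¹ * (logSize A - τ * x) ^ 2 := by positivity
      have h3 : (τ * x)⁻¹ * (logSize A - τ * x) ^ 2 =
          (τ * x)⁻¹ * logSize A ^ 2 - 2 * logSize A + τ * x := by
        field_simp
        ring
      linarith [logSize_nonneg A]
    · rw [Set.indicator_of_notMem hA, add_zero]
      have h1 : slNorm A ≤ D * Real.exp (t * x) := not_lt.mp hA
      have h2 := Real.log_le_log (slNorm_pos hd A) h1
      rw [Real.log_mul (by positivity) (Real.exp_pos _).ne', Real.log_exp] at h2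
      linarith
  have i1 : Integrable (fun A => (τ * x)⁻¹ * logSize A ^ 2) (ρ s : Measure (SL d)) :=
    (hmom s).1.const_mul _
  have i2 : Integrable (fun A => Real.log D + t * x + (τ * x)⁻¹ * logSize A ^ 2)
      (ρ s : Measure (SL d)) := (integrable_const _).add i1
  have hint := integral_mono ((hmom s).integrable_log_slNorm hd)
    (i2.add ((integrable_const (τ * x)).indicator (hbadm s))) hpt
  simp only [Pi.add_apply] at hint
  rw [integral_add i2 ((integrable_const (τ * x)).indicator (hbadm s)),
    integral_add (integrable_const _) i1, integral_indicator_const _ (hbadm s),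
    integral_const_mul] at hint
  simp only [integral_const, probReal_univ, smul_eq_mul, one_mul] at hint
  have h1 := hgrow s
  have h2 : (τ * x)⁻¹ * ∫ A, logSize A ^ 2 ∂(ρ s : Measure (SL d)) ≤ (lam - t) / 4 * x := by
    rw [inv_mul_le_iff₀ (by positivity)]
    refine (hmom s).2.trans ?_
    calc c * x ^ 2 ≤ (lam - t) / 4 * τ * x ^ 2 := by gcongr
      _ = _ := by ring
  have h3 : (ρ s : Measure (SL d)).real (bad s) * (τ * x) ≤ (lam - t) / 4 * x := by
    calc (ρ s : Measure (SL d)).real (bad s) * (τ * x) ≤ (lam - t) / (4 * τ) * (τ * x) := by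
          gcongr
      _ = _ := by field_simp
  rw [div_lt_iff₀ hδ] at hx1
  linarith

/-- A chain of proper nonzero subspaces mapped into each other almost surely contradicts the
spaces condition. -/
theorem not_forall_spacesCondition {κ : ℕ → ProbabilityMeasure (SL d)}
    {V : ℕ → Submodule ℝ (Fin d → ℝ)} (h0 : V 0 ≠ ⊥) (htop : ∀ n ≤ d, V n ≠ ⊤)
    (hmap : ∀ n < d, ∀ᵐ B : SL d ∂(κ n : Measure (SL d)),
      (V n).map (Matrix.toLin' (B : Matrix (Fin d) (Fin d) ℝ)) ≤ V (n + 1)) :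
    ¬ ∀ n, SpacesCondition (κ n) := by
  intro hsp
  have hrank : ∀ (n : ℕ) (B : SL d), Module.finrank ℝ
      ((V n).map (Matrix.toLin' (B : Matrix (Fin d) (Fin d) ℝ))) = Module.finrank ℝ (V n) :=
    fun n B => (Submodule.equivMapOfInjective _ (toLin'_injective B) (V n)).finrank_eq.symm
  have hlt : ∀ n < d, Module.finrank ℝ (V n) ≠ 0 →
      Module.finrank ℝ (V n) < Module.finrank ℝ (V (n + 1)) := by
    intro n hn hpos
    have hle : Module.finrank ℝ (V n) ≤ Module.finrank ℝ (V (n + 1)) := by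
      obtain ⟨B, hB⟩ := (hmap n hn).exists
      rw [← hrank n B]
      exact Submodule.finrank_mono hB
    refine lt_of_le_of_ne hle fun heq => hsp n ⟨_, _, ⟨{V n}, Set.finite_singleton _,
      Set.singleton_nonempty _, ?_, rfl⟩, ⟨{V (n + 1)}, Set.finite_singleton _,
      Set.singleton_nonempty _, ?_, rfl⟩, ?_⟩
    · rintro W rfl
      exact ⟨fun h => hpos (by rw [h, finrank_bot]), htop n hn.le⟩
    · rintro W rfl
      exact ⟨fun h => hpos (by rw [heq, h, finrank_bot]), htop _ hn⟩
    · filter_upwards [hmap n hn] with B hB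
      have := Submodule.eq_of_le_of_finrank_eq hB ((hrank n B).trans heq)
      simp only [Set.biUnion_singleton]
      rw [← this]
      rfl
  have hge : ∀ n ≤ d, n + 1 ≤ Module.finrank ℝ (V n) := by
    intro n
    induction n with
    | zero =>
      intro _
      exact Submodule.one_le_finrank_iff.mpr h0
    | succ n ih =>
      intro hn
      have h1 := ih (by omega)
      have h2 := hlt n (by omega) (by omega)
      omega
  have h1 := hge d le_rfl
  have h2 := Submodule.finrank_le (V d)
  rw [Module.finrank_fin_fun] at h2
  omega

end SlowSpace

section UniformGrowth

variable {d : ℕ}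

/-- Linear growth of `E log ‖A_N ⋯ A_1‖` over a compact shift-invariant family of sequences of laws
satisfying the spaces condition forces uniform mean growth of all vectors. -/
theorem uniformGrowth_of_spacesCondition (hd : 0 < d)
    {X : Set (ℕ → ProbabilityMeasure (SL d))} {lam c : ℝ} (hlam : 0 < lam)
    (hX : IsCompact X) (hshift : ∀ κ ∈ X, ∀ a, shiftSeq a κ ∈ X) (hc : 0 ≤ c)
    (hmom : ∀ κ ∈ X, ∀ i, SqMomentLE (κ i) c) (hsp : ∀ κ ∈ X, ∀ i, SpacesCondition (κ i))
    (hgrow : ∀ κ ∈ X, ∀ N : ℕ,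
      lam * N ≤ ∫ A, Real.log (slNorm A) ∂(prodLaw κ N : Measure (SL d))) :
    UniformGrowth X (lam / 2) := by
  by_contra hnot
  obtain ⟨a, ha, hlt, κ, hκ, u, hu, hslow⟩ := exists_critical_rate hX hshift hc hmom hnot
  set t := 3 * lam / 4 with ht
  have hstep : ∀ s : ℕ, ∃ N ≥ d + s, (prodLaw κ N : Measure (SL d)).real
      {A | t * N < Real.log ‖slVec A u‖} ≤ (1 / 2) ^ s := fun s =>
    exists_measureReal_log_norm_slVec_le hshift hmom hlt hκ hu hslow (by linarith)
      (by positivity) (d + s)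
  choose N hN hNs using hstep
  refine not_forall_spacesCondition (κ := κ)
    (V := fun n => slowSpace (fun s => prodLaw (shiftSeq n κ) (N s - n))
      (fun s => Real.exp (t * N s))) ?_ ?_ ?_ (hsp κ hκ)
  · rw [Submodule.ne_bot_iff]
    refine ⟨u.ofLp, mem_slowSpace.mpr ⟨1, zero_le_one, ?_⟩, fun h => ?_⟩
    · have hsum : ∑' s : ℕ, ENNReal.ofReal ((1 / 2 : ℝ) ^ s) ≠ ∞ :=
        summable_geometric_two.tsum_ofReal_ne_top
      refine ne_top_of_le_ne_top hsum (ENNReal.tsum_le_tsum fun s => ?_)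
      simp only [one_mul, shiftSeq_zero, Nat.sub_zero]
      rw [← ofReal_measureReal]
      refine ENNReal.ofReal_le_ofReal (le_trans (measureReal_mono fun A hA => ?_) (hNs s))
      exact (Real.lt_log_iff_exp_lt (norm_slVec_pos A hu)).mpr hA
    · have : u = 0 := by
        ext i
        exact congrFun h i
      simp [this] at hu
  · intro n hn
    refine slowSpace_ne_top hd (fun s => le_trans (Nat.le_add_left _ _) (hN s)) (by positivity)
      (by linarith : t < lam) hc (b := lam * n) (fun s => ?_) fun s => ?_
    · have h := sqMomentLE_prodLaw (hmom _ (hshift κ hκ n)) (N s - n)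
      refine ⟨h.1, h.2.trans ?_⟩
      gcongr
      exact Nat.sub_le _ _
    · have := hgrow _ (hshift κ hκ n) (N s - n)
      have hle : n ≤ N s := hn.trans (le_trans (Nat.le_add_right _ _) (hN s))
      rw [Nat.cast_sub hle] at this
      linarith
  · intro n hn
    refine ae_map_slowSpace_le fun s => ?_
    have hle : n + 1 ≤ N s := le_trans (by omega) (hN s)
    have hrw : N s - n = 1 + (N s - (n + 1)) := by omega
    rw [hrw, prodLaw_add, prodLaw_one, shiftSeq_shiftSeq]
    rfl

end UniformGrowth

section Assembly

variable {d : ℕ}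

theorem exists_sqMomentLE {γ : ℝ} (hγ : 0 < γ) (C : ℝ) :
    ∃ c : ℝ, 0 ≤ c ∧ ∀ μ : ProbabilityMeasure (SL d), FiniteMomentCondition γ C μ →
      SqMomentLE μ c := by
  obtain ⟨a, ha, hle⟩ := exists_logSize_le d
  set b : ℝ := 2 * ((d + 1) * (γ / 2)⁻¹) ^ 2 with hb
  have hb0 : 0 ≤ b := by positivity
  have hpt : ∀ A : SL d, logSize A ^ 2 ≤ 2 * a ^ 2 + b * slNorm A ^ γ := fun A => by
    have h0 := slNorm_nonneg A
    have h1 : Real.posLog (slNorm A) ≤ (γ / 2)⁻¹ * slNorm A ^ (γ / 2) := by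
      refine max_le (by positivity) ?_
      rw [inv_mul_eq_div]
      exact Real.log_le_rpow_div h0 (by positivity)
    have h2 : logSize A ≤ a + (d + 1) * ((γ / 2)⁻¹ * slNorm A ^ (γ / 2)) :=
      (hle A).trans (by gcongr)
    have h3 : (slNorm A ^ (γ / 2)) ^ 2 = slNorm A ^ γ := by
      rw [← Real.rpow_natCast, ← Real.rpow_mul h0]
      norm_num
    calc logSize A ^ 2 ≤ (a + (d + 1) * ((γ / 2)⁻¹ * slNorm A ^ (γ / 2))) ^ 2 :=
          pow_le_pow_left₀ (logSize_nonneg A) h2 2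
      _ ≤ 2 * a ^ 2 + 2 * ((d + 1) * ((γ / 2)⁻¹ * slNorm A ^ (γ / 2))) ^ 2 := by
          nlinarith [sq_nonneg (a - (d + 1) * ((γ / 2)⁻¹ * slNorm A ^ (γ / 2)))]
      _ = 2 * a ^ 2 + b * slNorm A ^ γ := by
          rw [← h3, hb]
          ring
  refine ⟨2 * a ^ 2 + b * |C|, by positivity, fun μ hμ => ?_⟩
  have hcont : Continuous fun A : SL d => slNorm A ^ γ :=
    continuous_slNorm.rpow_const fun _ => Or.inr hγ.le
  have hnn : ∀ A : SL d, 0 ≤ slNorm A ^ γ := fun A => Real.rpow_nonneg (slNorm_nonneg A) γ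
  have hint : Integrable (fun A : SL d => slNorm A ^ γ) (μ : Measure (SL d)) := by
    refine ⟨hcont.measurable.aestronglyMeasurable, ?_⟩
    rw [hasFiniteIntegral_iff_ofReal (ae_of_all _ hnn)]
    exact hμ.trans ENNReal.ofReal_lt_top
  have hval : ∫ A, slNorm A ^ γ ∂(μ : Measure (SL d)) ≤ |C| := by
    rw [integral_eq_lintegral_of_nonneg_ae (ae_of_all _ hnn) hcont.measurable.aestronglyMeasurable]
    refine (ENNReal.toReal_mono ENNReal.ofReal_ne_top hμ.le).trans ?_
    rw [ENNReal.toReal_ofReal']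
    exact max_le (le_abs_self C) (abs_nonneg C)
  have hbound : Integrable (fun A : SL d => 2 * a ^ 2 + b * slNorm A ^ γ) (μ : Measure (SL d)) :=
    (integrable_const _).add (hint.const_mul b)
  have hsq : Integrable (fun A : SL d => logSize A ^ 2) (μ : Measure (SL d)) := by
    refine hbound.mono' (continuous_logSize.pow 2).measurable.aestronglyMeasurable
      (ae_of_all _ fun A => ?_)
    rw [Real.norm_eq_abs, abs_of_nonneg (by positivity)]
    exact hpt A
  refine ⟨hsq, (integral_mono hsq hbound hpt).trans ?_⟩
  rw [integral_add (integrable_const _) (hint.const_mul b), integral_const_mul b]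
  simp only [integral_const, probReal_univ, one_smul]
  gcongr

/-- The sequences in `K` all of whose segments satisfy `E log ‖A_k ⋯ A_1‖ ≥ lam * k`. -/
def growingSeqs (K : Set (ProbabilityMeasure (SL d))) (lam : ℝ) :
    Set (ℕ → ProbabilityMeasure (SL d)) :=
  {κ | (∀ i, κ i ∈ K) ∧ ∀ a k : ℕ,
    lam * k ≤ ∫ A, Real.log (slNorm A) ∂(prodLaw (shiftSeq a κ) k : Measure (SL d))}

theorem isCompact_growingSeqs (hd : 0 < d) {K : Set (ProbabilityMeasure (SL d))}
    (hK : IsCompact K) {c : ℝ} (hmom : ∀ μ ∈ K, SqMomentLE μ c) (lam : ℝ) :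
    IsCompact (growingSeqs K lam) := by
  set P : Set (ℕ → ProbabilityMeasure (SL d)) := Set.univ.pi fun _ => K with hP
  have hPK : ∀ κ ∈ P, ∀ i, κ i ∈ K := fun κ hκ i => hκ i (Set.mem_univ i)
  have hPc : IsCompact P := isCompact_univ_pi fun _ => hK
  have : CompactSpace P := isCompact_iff_compactSpace.mp hPc
  have hclosed : IsClosed {y : P | ∀ a k : ℕ,
      lam * k ≤ ∫ A, Real.log (slNorm A) ∂(prodLaw (shiftSeq a y.1) k : Measure (SL d))} := by
    simp only [Set.ofPred_forall]
    refine isClosed_iInter fun a => isClosed_iInter fun k => isClosed_le continuous_const ?_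
    exact continuous_integral_log_slNorm hd
      (((continuous_prodLaw k).comp (continuous_shiftSeq a)).comp continuous_subtype_val)
      fun y => sqMomentLE_prodLaw (fun i => hmom _ (hPK _ y.2 (a + i))) k
  convert hclosed.isCompact.image continuous_subtype_val using 1
  ext κ
  constructor
  · exact fun h => ⟨⟨κ, fun i _ => h.1 i⟩, h.2, rfl⟩
  · rintro ⟨y, hy, rfl⟩
    exact ⟨hPK _ y.2, hy⟩

theorem shiftSeq_mem_growingSeqs {K : Set (ProbabilityMeasure (SL d))} {lam : ℝ}
    {κ : ℕ → ProbabilityMeasure (SL d)} (hκ : κ ∈ growingSeqs K lam) (a : ℕ) :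
    shiftSeq a κ ∈ growingSeqs K lam :=
  ⟨fun i => hκ.1 (a + i), fun b k => by
    rw [shiftSeq_shiftSeq]
    exact hκ.2 (a + b) k⟩

theorem measurable_T (n : ℕ) : Measurable fun ω : ℕ → SL d => T ω n := by
  induction n with
  | zero => exact measurable_const
  | succ n ih => exact (measurable_pi_apply n).mul ih

theorem T_congr {ω ω' : ℕ → SL d} {n : ℕ} (h : ∀ i < n, ω i = ω' i) : T ω n = T ω' n := by
  induction n with
  | zero => rfl
  | succ n ih => rw [T, T, ih fun i hi => h i (by omega), h n (by omega)]

/-- Under a product measure, the coordinate `m` is independent of the functions of the previous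
coordinates. -/
theorem map_prodMk_of_isProductMeasure {μ : ℕ → ProbabilityMeasure (SL d)}
    {ℙ : Measure (ℕ → SL d)} (hℙ : IsProductMeasure μ ℙ) (m : ℕ) {G : (Fin m → SL d) → SL d}
    (hG : Measurable G) :
    ℙ.map (fun ω => (ω m, G fun i => ω i)) =
      (μ m : Measure (SL d)).prod (ℙ.map fun ω => G fun i => ω i) := by
  have hr : ∀ k : ℕ, Measurable fun (ω : ℕ → SL d) (i : Fin k) => ω i := fun k => by fun_prop
  have h1 : ℙ.map (fun ω => (ω m, fun i : Fin m => ω i)) =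
      (μ m : Measure (SL d)).prod (Measure.pi fun i : Fin m => (μ i : Measure (SL d))) := by
    have hmp := (measurePreserving_piFinSuccAbove
      (fun i : Fin (m + 1) => (μ i : Measure (SL d))) (Fin.last m)).map_eq
    rw [← hℙ.2 (m + 1), Measure.map_map (MeasurableEquiv.measurable _) (hr _)] at hmp
    simpa [Function.comp_def, MeasurableEquiv.piFinSuccAbove, Fin.init_def] using hmp
  have : IsProbabilityMeasure ℙ := hℙ.1
  have h2 : ℙ.map (fun ω => G fun i => ω i) =
      (Measure.pi fun i : Fin m => (μ i : Measure (SL d))).map G := by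
    rw [← hℙ.2 m, Measure.map_map hG (hr m)]
    rfl
  have h3 : ℙ.map (fun ω => (ω m, G fun i => ω i)) =
      (ℙ.map (fun ω => (ω m, fun i : Fin m => ω i))).map (Prod.map id G) := by
    rw [Measure.map_map (measurable_id.prodMap hG) ((measurable_pi_apply m).prodMk (hr m))]
    rfl
  rw [h3, h1, h2, ← Measure.map_prod_map _ _ measurable_id hG, Measure.map_id]

theorem map_T_mul_inv {μ : ℕ → ProbabilityMeasure (SL d)} {ℙ : Measure (ℕ → SL d)}
    (hℙ : IsProductMeasure μ ℙ) (n k : ℕ) :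
    ℙ.map (fun ω => T ω (n + k) * (T ω n)⁻¹) = (prodLaw (shiftSeq n μ) k : Measure (SL d)) := by
  have : IsProbabilityMeasure ℙ := hℙ.1
  induction k with
  | zero =>
    simp only [add_zero, mul_inv_cancel, Measure.map_const, measure_univ, one_smul]
    rfl
  | succ k ih =>
    let ext : (Fin (n + k) → SL d) → ℕ → SL d := fun x i =>
      if h : i < n + k then x ⟨i, h⟩ else 1
    have hext : Measurable ext := measurable_pi_lambda _ fun i => by
      by_cases h : i < n + k
      · simp only [ext, h, dite_true]
        exact measurable_pi_apply _
      · simp only [ext, h, dite_false]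
        exact measurable_const
    have hT : ∀ (ω : ℕ → SL d), ∀ j ≤ n + k, T (ext fun i => ω i) j = T ω j := fun ω j hj =>
      T_congr fun i hi => by simp [ext, hi.trans_le hj]
    let G : (Fin (n + k) → SL d) → SL d := fun x => T (ext x) (n + k) * (T (ext x) n)⁻¹
    have hG : Measurable G :=
      ((measurable_T _).comp hext).mul ((measurable_T _).comp hext).inv
    have hGT : ∀ ω : ℕ → SL d, G (fun i => ω i) = T ω (n + k) * (T ω n)⁻¹ := fun ω => by
      simp only [G]
      rw [hT ω _ le_rfl, hT ω _ (Nat.le_add_right n k)]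
    have hlaw := map_prodMk_of_isProductMeasure hℙ (n + k) hG
    simp only [hGT] at hlaw
    rw [ih] at hlaw
    have hmeas : Measurable fun ω : ℕ → SL d => (ω (n + k), T ω (n + k) * (T ω n)⁻¹) :=
      (measurable_pi_apply _).prodMk ((measurable_T _).mul (measurable_T _).inv)
    have hcomp : (fun ω : ℕ → SL d => T ω (n + (k + 1)) * (T ω n)⁻¹) =
        (fun p : SL d × SL d => p.1 * p.2) ∘
          fun ω => (ω (n + k), T ω (n + k) * (T ω n)⁻¹) := by
      ext1 ω
      exact mul_assoc _ _ _
    rw [hcomp, ← Measure.map_map measurable_mul hmeas, hlaw]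
    rfl

theorem Lseg_eq {μ : ℕ → ProbabilityMeasure (SL d)} {ℙ : Measure (ℕ → SL d)} (hd : 0 < d)
    (hℙ : IsProductMeasure μ ℙ) (n k : ℕ) :
    Lseg ℙ n (n + k) =
      ∫ A, Real.log (slNorm A) ∂(prodLaw (shiftSeq n μ) k : Measure (SL d)) := by
  have hmeas : Measurable fun ω : ℕ → SL d => T ω (n + k) * (T ω n)⁻¹ :=
    (measurable_T _).mul (measurable_T _).inv
  rw [← map_T_mul_inv hℙ, integral_map hmeas.aemeasurable
    (continuous_log_slNorm hd).measurable.aestronglyMeasurable]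
  rfl

theorem L_eq {μ : ℕ → ProbabilityMeasure (SL d)} {ℙ : Measure (ℕ → SL d)} (hd : 0 < d)
    (hℙ : IsProductMeasure μ ℙ) (n : ℕ) :
    L ℙ n = ∫ A, Real.log (slNorm A) ∂(prodLaw μ n : Measure (SL d)) := by
  have := Lseg_eq hd hℙ 0 n
  rw [shiftSeq_zero] at this
  rw [← this]
  simp [L, Lseg, T]

/-- Quantitative superadditivity of the expected log-norms. -/
theorem exists_add_le_L (hd : 0 < d) {K : Set (ProbabilityMeasure (SL d))} (hK : IsCompact K)
    {γ C : ℝ} (hγ : 0 < γ) (hmom : ∀ μ ∈ K, FiniteMomentCondition γ C μ)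
    (hsp : ∀ μ ∈ K, SpacesCondition μ) {μ : ℕ → ProbabilityMeasure (SL d)} (hμ : ∀ i, μ i ∈ K)
    {ℙ : Measure (ℕ → SL d)} (hℙ : IsProductMeasure μ ℙ) {lam : ℝ} (hlam : 0 < lam)
    (hgrow : ∀ n m : ℕ, n ≤ m → lam * ((m : ℝ) - (n : ℝ)) ≤ Lseg ℙ n m) :
    ∃ Cb : ℝ, ∀ n k : ℕ, L ℙ n + lam / 2 * k - Cb ≤ L ℙ (n + k) := by
  obtain ⟨c, hc, hmom'⟩ := exists_sqMomentLE (d := d) hγ C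
  have hmomK : ∀ ν ∈ K, SqMomentLE ν c := fun ν hν => hmom' ν (hmom ν hν)
  have hμX : μ ∈ growingSeqs K lam := ⟨hμ, fun a k => by
    rw [← Lseg_eq hd hℙ]
    simpa using hgrow a (a + k) (Nat.le_add_right a k)⟩
  obtain ⟨Cb, hCb⟩ := uniformGrowth_of_spacesCondition hd hlam
    (isCompact_growingSeqs hd hK hmomK lam) (fun κ hκ a => shiftSeq_mem_growingSeqs hκ a) hc
    (fun κ hκ i => hmomK _ (hκ.1 i)) (fun κ hκ i => hsp _ (hκ.1 i))
    (fun κ hκ N => by simpa using hκ.2 0 N)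
  refine ⟨Cb, fun n k => ?_⟩
  have hm := fun i => hmomK _ (hμ i)
  have := add_le_integral_log_slNorm_mulLaw hd
    (sqMomentLE_prodLaw (κ := shiftSeq n μ) (fun i => hm (n + i)) k)
    (sqMomentLE_prodLaw hm n) (prodLaw_add μ n k ▸ sqMomentLE_prodLaw hm (n + k))
    (hCb _ (shiftSeq_mem_growingSeqs hμX n) k)
  rw [L_eq hd hℙ, L_eq hd hℙ, prodLaw_add]
  linarith

end Assembly

/-- **Monotone approximation of the expected log-norms** (Corollary 3.7).
With `f(n) = min_{m ≥ n} (L_m - (λ/2)(m-n))`, the function `f` is increasing with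
increments at least `λ/2`, and `Lₙ ≥ f(n) ≥ Lₙ - C` for a uniform constant `C`. -/
theorem monotone_approximation
    (d : ℕ) (hd : 0 < d)
    (K : Set (ProbabilityMeasure (SL d))) (hK : IsCompact K)
    (γ C : ℝ) (hγ : 0 < γ)
    (hmom : ∀ μ ∈ K, FiniteMomentCondition γ C μ)
    (hmeas : ∀ μ ∈ K, MeasuresCondition μ)
    (hsp : ∀ μ ∈ K, SpacesCondition μ)
    (μ : ℕ → ProbabilityMeasure (SL d)) (hμ : ∀ i, μ i ∈ K)
    (ℙ : Measure (ℕ → SL d)) (hℙ : IsProductMeasure μ ℙ)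
    (lam : ℝ) (hlam : 0 < lam)
    (hgrow : ∀ n m : ℕ, n ≤ m → lam * ((m : ℝ) - (n : ℝ)) ≤ Lseg ℙ n m)
    (f : ℕ → ℝ)
    (hf : ∀ n : ℕ, f n = ⨅ m : {m : ℕ // n ≤ m},
      (L ℙ (m : ℕ) - lam / 2 * (((m : ℕ) : ℝ) - (n : ℝ)))) :
    (∀ n : ℕ, lam / 2 ≤ f (n + 1) - f n) ∧
      ∃ Cb : ℝ, ∀ n : ℕ, f n ≤ L ℙ n ∧ L ℙ n - Cb ≤ f n := by
  obtain ⟨Cb, hCb⟩ := exists_add_le_L hd hK hγ hmom hsp hμ hℙ hlam hgrow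
  have hlow : ∀ n m : ℕ, n ≤ m → L ℙ n - Cb ≤ L ℙ m - lam / 2 * ((m : ℝ) - n) := by
    intro n m hnm
    obtain ⟨k, rfl⟩ := Nat.exists_eq_add_of_le hnm
    have := hCb n k
    push_cast
    linarith
  have hle : ∀ n m : ℕ, n ≤ m → f n ≤ L ℙ m - lam / 2 * ((m : ℝ) - n) := fun n m hnm => by
    rw [hf]
    refine ciInf_le (f := fun m : {m : ℕ // n ≤ m} =>
      L ℙ (m : ℕ) - lam / 2 * (((m : ℕ) : ℝ) - (n : ℝ))) ⟨L ℙ n - Cb, ?_⟩ ⟨m, hnm⟩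
    rintro _ ⟨m', rfl⟩
    exact hlow n m' m'.2
  refine ⟨fun n => ?_, Cb, fun n => ⟨by simpa using hle n n le_rfl, ?_⟩⟩
  · have : Nonempty {m : ℕ // n + 1 ≤ m} := ⟨⟨n + 1, le_rfl⟩⟩
    rw [le_sub_iff_add_le, hf (n + 1)]
    refine le_ciInf fun m => ?_
    have := hle n m (n.le_succ.trans m.2)
    push_cast
    linarith
  · have : Nonempty {m : ℕ // n ≤ m} := ⟨⟨n, le_rfl⟩⟩
    rw [hf n]
    exact le_ciInf fun m => hlow n m m.2
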